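/- arXiv:1304.7014 — 4 statements merged into one kernel-verified Lean document; each statement's English description precedes it below -/
import Mathlib

section
/- The infimum in the definition of T_p^{a,b}(μ,ν) = inf_{|μ̃|=|ν̃|} a^p(|μ−μ̃|+|ν−ν̃|)^p + b^p W_p^p(μ̃,ν̃) is attained: there exist measures μ̃ ≤ μ, ν̃ ≤ ν with |μ̃| = |ν̃| achieving the infimum. -/
open MeasureTheory Set
open scoped ENNReal NNReal

noncomputable section

abbrev Rd (d : ℕ) := EuclideanSpace ℝ (Fin d)

/-- Transference plans: probability measures on the product with normalized marginals. -/
def IsPlan {d : ℕ} (μ ν : Measure (Rd d)) (π : Measure (Rd d × Rd d)) : Prop :=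
  IsProbabilityMeasure π ∧ π.map Prod.fst = (μ Set.univ)⁻¹ • μ ∧
    π.map Prod.snd = (ν Set.univ)⁻¹ • ν

/-- Cost of a plan. -/
def planCost {d : ℕ} (p : ℝ) (π : Measure (Rd d × Rd d)) : ℝ≥0∞ :=
  ∫⁻ q, (edist q.1 q.2) ^ p ∂π

/-- Mass-scaled Wasserstein distance `W_p(μ,ν) = |μ| (inf_π ∫ |x-y|^p dπ)^{1/p}`. -/
def Wp {d : ℕ} (p : ℝ) (μ ν : Measure (Rd d)) : ℝ≥0∞ :=
  μ Set.univ * (⨅ π : {π : Measure (Rd d × Rd d) // IsPlan μ ν π}, planCost p π.1) ^ (1/p)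

/-- Total variation norm `|μ - ν|` of the difference of two measures. -/
def tv {d : ℕ} (μ ν : Measure (Rd d)) : ℝ≥0∞ := (μ - ν) Set.univ + (ν - μ) Set.univ

/-- Finite mass and finite `p`-th moment. -/
def finMom {d : ℕ} (p : ℝ) (μ : Measure (Rd d)) : Prop :=
  IsFiniteMeasure μ ∧ ∫⁻ x, (‖x‖₊ : ℝ≥0∞) ^ p ∂μ ≠ ⊤

/-- The functional `T_p^{a,b}`. -/
def Tab {d : ℕ} (a b p : ℝ) (μ ν : Measure (Rd d)) : ℝ≥0∞ :=
  ⨅ (μ' : Measure (Rd d)) (ν' : Measure (Rd d)) (_ : IsFiniteMeasure μ')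
    (_ : IsFiniteMeasure ν') (_ : μ' Set.univ = ν' Set.univ),
    ENNReal.ofReal a ^ p * (tv μ μ' + tv ν ν') ^ p + ENNReal.ofReal b ^ p * Wp p μ' ν' ^ p

/-- The generalized Wasserstein distance `W_p^{a,b}`. -/
def Wab {d : ℕ} (a b p : ℝ) (μ ν : Measure (Rd d)) : ℝ≥0∞ := Tab a b p μ ν ^ (1/p)

open Filter Topology BoundedContinuousFunction

section Helpers

variable {X : Type*} [MeasurableSpace X]

lemma aux_measure_le [TopologicalSpace X] [TopologicalSpace.PseudoMetrizableSpace X] [BorelSpace X]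
    {α β : Measure X} [IsFiniteMeasure α] [IsFiniteMeasure β]
    (h : ∀ f : X →ᵇ ℝ≥0, ∫⁻ x, f x ∂α ≤ ∫⁻ x, f x ∂β) : α ≤ β := by
  let _ := TopologicalSpace.pseudoMetrizableSpacePseudoMetric X
  have hc : ∀ F : Set X, IsClosed F → α F ≤ β F := fun F hF =>
    le_of_tendsto_of_tendsto' (HasOuterApproxClosed.tendsto_lintegral_apprSeq hF α)
      (HasOuterApproxClosed.tendsto_lintegral_apprSeq hF β) (fun n => h _)
  refine Measure.le_iff.2 fun s hs => ?_
  rw [hs.measure_eq_iSup_isClosed_of_ne_top (measure_ne_top α s)]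
  refine iSup_le fun K => iSup_le fun hK => iSup_le fun hKc => ?_
  exact (hc K hKc).trans (measure_mono hK)

lemma aux_sub_add (μ μ' : Measure X) [IsFiniteMeasure μ] [IsFiniteMeasure μ'] :
    μ + (μ' - μ) = μ' + (μ - μ') := by
  have h1 : μ ≪ μ + μ' := Measure.absolutelyContinuous_of_le (Measure.le_add_right le_rfl)
  have h2 : μ' ≪ μ + μ' := Measure.absolutelyContinuous_of_le (Measure.le_add_left le_rfl)
  have e1 := Measure.withDensity_rnDeriv_eq _ _ h1
  have e2 := Measure.withDensity_rnDeriv_eq _ _ h2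
  set σ := μ + μ'
  set f := μ.rnDeriv σ with hf
  set g := μ'.rnDeriv σ with hg
  have mf : Measurable f := Measure.measurable_rnDeriv _ _
  have mg : Measurable g := Measure.measurable_rnDeriv _ _
  have f1 : IsFiniteMeasure (σ.withDensity f) := by rw [e1]; infer_instance
  have f2 : IsFiniteMeasure (σ.withDensity g) := by rw [e2]; infer_instance
  rw [← e1, ← e2, ← Measure.withDensity_sub mf mg, ← Measure.withDensity_sub mg mf,
    ← withDensity_add_left mf, ← withDensity_add_left mg]
  congr 1
  funext x
  simp only [Pi.add_apply, Pi.sub_apply]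
  rw [add_tsub_eq_max, add_tsub_eq_max, max_comm]

lemma aux_trim (μ μ' : Measure X) [IsFiniteMeasure μ] [IsFiniteMeasure μ'] :
    ∃ f : X → ℝ≥0∞, Measurable f ∧ (∀ x, f x ≤ 1) ∧ μ'.withDensity f ≤ μ ∧
      ∫⁻ x, (1 - f x) ∂μ' ≤ (μ' - μ) univ := by
  set α := μ' - (μ' - μ) with hα
  have hle : α ≤ μ' := Measure.sub_le
  have hαμ : α ≤ μ := by
    apply Measure.sub_le_of_le_add
    rw [aux_sub_add]
    exact Measure.le_add_right le_rfl
  have hαf : IsFiniteMeasure α := isFiniteMeasure_of_le _ hle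
  have hac : α ≪ μ' := Measure.absolutelyContinuous_of_le hle
  have e := Measure.withDensity_rnDeriv_eq _ _ hac
  have h1 := Measure.rnDeriv_le_one_of_le hle
  have hm : Measurable (fun x => min (α.rnDeriv μ' x) 1) :=
    (Measure.measurable_rnDeriv _ _).min measurable_const
  have e' : μ'.withDensity (fun x => min (α.rnDeriv μ' x) 1) = α := by
    rw [← e]
    conv_rhs => rw [e]
    rw [← e]
    refine (withDensity_congr_ae ?_)
    filter_upwards [h1] with x hx
    simpa [e] using hx
  refine ⟨fun x => min (α.rnDeriv μ' x) 1, hm, fun x => min_le_right _ _, ?_, ?_⟩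
  · rw [e']; exact hαμ
  · have hi : ∫⁻ x, min (α.rnDeriv μ' x) 1 ∂μ' = α univ := by
      rw [← e', withDensity_apply _ MeasurableSet.univ, Measure.restrict_univ, e']
    rw [lintegral_sub hm (by rw [hi]; exact measure_ne_top _ _)
      (ae_of_all _ fun x => min_le_right _ _), hi, lintegral_one]
    rw [hα, Measure.sub_apply MeasurableSet.univ Measure.sub_le]
    rw [ENNReal.sub_sub_cancel (measure_ne_top _ _) (Measure.sub_le _)]

end Helpers

section Main

variable {d : ℕ}

def aux_K (μ ν : Measure (Rd d)) : Set (FiniteMeasure (Rd d × Rd d)) :=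
  {γ | (γ : Measure (Rd d × Rd d)).map Prod.fst ≤ μ ∧
    (γ : Measure (Rd d × Rd d)).map Prod.snd ≤ ν}

lemma aux_closed (μ : Measure (Rd d)) [IsFiniteMeasure μ] {φ : Rd d × Rd d → Rd d}
    (hφ : Continuous φ) :
    IsClosed {γ : FiniteMeasure (Rd d × Rd d) | (γ : Measure (Rd d × Rd d)).map φ ≤ μ} := by
  have : {γ : FiniteMeasure (Rd d × Rd d) | (γ : Measure (Rd d × Rd d)).map φ ≤ μ} =
      ⋂ f : Rd d →ᵇ ℝ≥0, {γ : FiniteMeasure (Rd d × Rd d) |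
        (γ.testAgainstNN (f.compContinuous ⟨φ, hφ⟩) : ℝ≥0∞) ≤ ∫⁻ x, f x ∂μ} := by
    ext γ
    have key : ∀ f : Rd d →ᵇ ℝ≥0, (γ.testAgainstNN (f.compContinuous ⟨φ, hφ⟩) : ℝ≥0∞)
        = ∫⁻ x, f x ∂((γ : Measure (Rd d × Rd d)).map φ) := by
      intro f
      rw [FiniteMeasure.testAgainstNN_coe_eq, lintegral_map (by fun_prop) hφ.measurable]
      rfl
    simp only [mem_ofPred_eq, mem_iInter, key]
    exact ⟨fun h f => lintegral_mono' h le_rfl, fun h => aux_measure_le h⟩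
  rw [this]
  refine isClosed_iInter fun f => ?_
  exact isClosed_le (ENNReal.continuous_coe.comp
    (FiniteMeasure.continuous_testAgainstNN_eval _)) continuous_const

lemma aux_compact_seq (μ : Measure (Rd d)) [IsFiniteMeasure μ] :
    ∃ K : ℕ → Set (Rd d), (∀ n, IsCompact (K n)) ∧ ∀ n, μ (K n)ᶜ ≤ ((1 / (n + 1) : ℝ≥0) : ℝ≥0∞) := by
  have h := isTightMeasureSet_iff_exists_isCompact_measure_compl_le.1
    (isTightMeasureSet_singleton (μ := μ))
  have h' : ∀ n : ℕ, ∃ K : Set (Rd d), IsCompact K ∧ μ Kᶜ ≤ ((1 / (n + 1) : ℝ≥0) : ℝ≥0∞) := by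
    intro n
    obtain ⟨K, hK, hK'⟩ := h ((1 / (n + 1) : ℝ≥0) : ℝ≥0∞)
      (by rw [ENNReal.coe_pos]; positivity)
    exact ⟨K, hK, hK' _ rfl⟩
  choose K hK using h'
  exact ⟨K, fun n => (hK n).1, fun n => (hK n).2⟩

lemma aux_compact (μ ν : Measure (Rd d)) [IsFiniteMeasure μ] [IsFiniteMeasure ν] :
    IsCompact (aux_K μ ν) := by
  obtain ⟨K, hK, hKμ⟩ := aux_compact_seq μ
  obtain ⟨L, hL, hLν⟩ := aux_compact_seq ν
  have hu : Tendsto (fun n : ℕ => (1 / (n + 1) + 1 / (n + 1) : ℝ≥0)) atTop (𝓝 0) := by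
    have : Tendsto (fun n : ℕ => (1 / (n + 1) : ℝ≥0)) atTop (𝓝 0) :=
      tendsto_one_div_add_atTop_nhds_zero_nat (𝕜 := ℝ≥0)
    simpa using this.add this
  have hc := isCompact_setOfPred_finiteMeasure_mass_le_compl_isCompact_le
    (μ univ).toNNReal hu (fun n => (hK n).prod (hL n)) (Or.inl inferInstance)
  refine hc.of_isClosed_subset ?_ ?_
  · exact (aux_closed μ continuous_fst).inter (aux_closed ν continuous_snd)
  · rintro γ ⟨h1, h2⟩
    refine ⟨?_, fun n => ?_⟩
    · rw [← ENNReal.coe_le_coe, FiniteMeasure.ennreal_mass,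
        ENNReal.coe_toNNReal (measure_ne_top _ _)]
      have := h1 univ
      rwa [Measure.map_apply measurable_fst MeasurableSet.univ, preimage_univ] at this
    · rw [← ENNReal.coe_le_coe, FiniteMeasure.ennreal_coeFn_eq_coeFn_toMeasure, ENNReal.coe_add]
      have hsub : (K n ×ˢ L n)ᶜ ⊆ Prod.fst ⁻¹' (K n)ᶜ ∪ Prod.snd ⁻¹' (L n)ᶜ := by
        rintro ⟨x, y⟩ h
        simp only [mem_compl_iff, mem_prod, not_and_or] at h
        exact h
      refine (measure_mono hsub).trans ((measure_union_le _ _).trans (add_le_add ?_ ?_))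
      · rw [← Measure.map_apply measurable_fst (hK n).measurableSet.compl]
        exact (h1 _).trans (hKμ n)
      · rw [← Measure.map_apply measurable_snd (hL n).measurableSet.compl]
        exact (h2 _).trans (hLν n)

def aux_cost (p : ℝ) (n : ℕ) (hp : 0 ≤ p) : (Rd d × Rd d) →ᵇ ℝ≥0 :=
  BoundedContinuousFunction.mkOfBound
    ⟨fun q => min (nndist q.1 q.2 ^ p) n,
      ((NNReal.continuous_rpow_const hp).comp (by fun_prop)).min continuous_const⟩ n (by
    intro x y
    simp only [ContinuousMap.coe_mk, NNReal.dist_eq]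
    rw [abs_le]
    have h1 : ((min (nndist x.1 x.2 ^ p) n : ℝ≥0) : ℝ) ≤ n := by exact_mod_cast min_le_right _ _
    have h2 : ((min (nndist y.1 y.2 ^ p) n : ℝ≥0) : ℝ) ≤ n := by exact_mod_cast min_le_right _ _
    have h3 := (min (nndist x.1 x.2 ^ p) n : ℝ≥0).coe_nonneg
    have h4 := (min (nndist y.1 y.2 ^ p) n : ℝ≥0).coe_nonneg
    constructor <;> linarith)

lemma aux_cost_iSup (p : ℝ) (hp : 0 ≤ p) (γ : FiniteMeasure (Rd d × Rd d)) :
    planCost p (γ : Measure (Rd d × Rd d)) =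
      ⨆ n, (γ.testAgainstNN (aux_cost p n hp) : ℝ≥0∞) := by
  simp_rw [FiniteMeasure.testAgainstNN_coe_eq]
  rw [← lintegral_iSup]
  · unfold planCost
    refine lintegral_congr fun q => ?_
    have h1 : edist q.1 q.2 ^ p = ((nndist q.1 q.2 ^ p : ℝ≥0) : ℝ≥0∞) := by
      rw [edist_nndist, ENNReal.coe_rpow_of_nonneg _ hp]
    rw [h1]
    apply le_antisymm
    · obtain ⟨n, hn⟩ := exists_nat_ge (nndist q.1 q.2 ^ p)
      refine le_iSup_of_le n ?_
      rw [ENNReal.coe_le_coe]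
      exact le_min le_rfl hn
    · refine iSup_le fun n => ?_
      rw [ENNReal.coe_le_coe]
      exact min_le_left _ _
  · intro n
    fun_prop
  · intro m n h q
    simp only [ENNReal.coe_le_coe]
    exact min_le_min le_rfl (by exact_mod_cast h)

def aux_J (A B M : ℝ≥0∞) (p : ℝ) (γ : Measure (Rd d × Rd d)) : ℝ≥0∞ :=
  A * (M - 2 * γ univ) ^ p + B * (γ univ ^ (p - 1) * planCost p γ)

lemma aux_lsc (A B M : ℝ≥0∞) (hA : A ≠ ⊤) (hB : B ≠ ⊤) (hM : M ≠ ⊤) (p : ℝ) (hp : 1 ≤ p) :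
    LowerSemicontinuous
      (fun γ : FiniteMeasure (Rd d × Rd d) => aux_J A B M p (γ : Measure (Rd d × Rd d))) := by
  have hp0 : 0 ≤ p := by linarith
  have : (fun γ : FiniteMeasure (Rd d × Rd d) => aux_J A B M p (γ : Measure (Rd d × Rd d))) =
      fun γ => ⨆ n, (A * (M - 2 * (γ.mass : ℝ≥0∞)) ^ p +
        B * ((γ.mass ^ (p - 1) * γ.testAgainstNN (aux_cost p n hp0) : ℝ≥0) : ℝ≥0∞)) := by
    funext γ
    rw [aux_J, aux_cost_iSup p hp0, ENNReal.mul_iSup, ENNReal.mul_iSup, ENNReal.add_iSup]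
    simp only [FiniteMeasure.ennreal_mass, ENNReal.coe_mul,
      ENNReal.coe_rpow_of_nonneg _ (sub_nonneg.2 hp)]
  rw [this]
  refine lowerSemicontinuous_iSup fun n => Continuous.lowerSemicontinuous ?_
  refine Continuous.add ?_ ?_
  · refine (ENNReal.continuous_const_mul hA).comp (ENNReal.continuous_rpow_const.comp
      ((ENNReal.continuous_sub_left hM).comp ((ENNReal.continuous_const_mul (by simp)).comp
        (ENNReal.continuous_coe.comp FiniteMeasure.continuous_mass))))
  · refine (ENNReal.continuous_const_mul hB).comp (ENNReal.continuous_coe.comp ?_)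
    exact ((NNReal.continuous_rpow_const (sub_nonneg.2 hp)).comp
      FiniteMeasure.continuous_mass).mul (FiniteMeasure.continuous_testAgainstNN_eval _)

/-- The objective at the marginals is at most `J`. -/
lemma aux_upper (A B : ℝ≥0∞) (p : ℝ) (hp : 1 ≤ p)
    (μ ν : Measure (Rd d)) [IsFiniteMeasure μ] [IsFiniteMeasure ν]
    (γ : Measure (Rd d × Rd d)) [IsFiniteMeasure γ]
    (h1 : γ.map Prod.fst ≤ μ) (h2 : γ.map Prod.snd ≤ ν) :
    A * (tv μ (γ.map Prod.fst) + tv ν (γ.map Prod.snd)) ^ p +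
      B * Wp p (γ.map Prod.fst) (γ.map Prod.snd) ^ p ≤ aux_J A B (μ univ + ν univ) p γ := by
  have hp0 : 0 < p := by linarith
  have m1 : γ.map Prod.fst univ = γ univ := by
    rw [Measure.map_apply measurable_fst MeasurableSet.univ, preimage_univ]
  have m2 : γ.map Prod.snd univ = γ univ := by
    rw [Measure.map_apply measurable_snd MeasurableSet.univ, preimage_univ]
  have hγ : γ univ ≠ ⊤ := measure_ne_top _ _
  unfold aux_J
  refine add_le_add ?_ ?_
  · gcongr
    rw [tv, tv, Measure.sub_eq_zero_of_le h1, Measure.sub_eq_zero_of_le h2,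
      Measure.sub_apply MeasurableSet.univ h1, Measure.sub_apply MeasurableSet.univ h2, m1, m2]
    simp only [Measure.coe_zero, Pi.zero_apply, add_zero]
    have i1 := h1 univ
    have i2 := h2 univ
    rw [m1] at i1
    rw [m2] at i2
    refine ENNReal.le_sub_of_add_le_right (ENNReal.mul_ne_top (by simp) hγ) ?_
    rw [two_mul, add_add_add_comm, tsub_add_cancel_of_le i1, tsub_add_cancel_of_le i2]
  · gcongr
    rw [Wp, m1]
    by_cases h0 : γ univ = 0
    · simp [h0, hp0]
    · have hplan : IsPlan (γ.map Prod.fst) (γ.map Prod.snd) ((γ univ)⁻¹ • γ) := by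
        refine ⟨⟨?_⟩, ?_, ?_⟩
        · simp [ENNReal.inv_mul_cancel h0 hγ]
        · rw [m1, Measure.map_smul]
        · rw [m2, Measure.map_smul]
      have hle : (⨅ π : {π : Measure (Rd d × Rd d) //
          IsPlan (γ.map Prod.fst) (γ.map Prod.snd) π}, planCost p π.1) ≤
            (γ univ)⁻¹ * planCost p γ := by
        refine (iInf_le _ ⟨_, hplan⟩).trans ?_
        simp [planCost, lintegral_smul_measure]
      rw [ENNReal.mul_rpow_of_nonneg _ _ hp0.le, ← ENNReal.rpow_mul, one_div,
        inv_mul_cancel₀ hp0.ne', ENNReal.rpow_one]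
      refine (mul_le_mul_right hle _).trans ?_
      rw [← mul_assoc, ENNReal.rpow_sub _ _ h0 hγ, ENNReal.rpow_one, ENNReal.div_eq_inv_mul,
        mul_comm (γ univ ^ p)]

/-- Trimming a plan. -/
lemma aux_lower (A B : ℝ≥0∞) (p : ℝ) (hp : 1 ≤ p)
    (μ ν μ' ν' : Measure (Rd d)) [IsFiniteMeasure μ] [IsFiniteMeasure ν]
    [IsFiniteMeasure μ'] [IsFiniteMeasure ν']
    (γ : Measure (Rd d × Rd d)) [IsFiniteMeasure γ]
    (h1 : γ.map Prod.fst = μ') (h2 : γ.map Prod.snd = ν') :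
    ∃ γ' ∈ aux_K μ ν, aux_J A B (μ univ + ν univ) p (γ' : Measure (Rd d × Rd d)) ≤
      A * (tv μ μ' + tv ν ν') ^ p + B * (γ univ ^ (p - 1) * planCost p γ) := by
  obtain ⟨f, mf, f1, fμ, fd⟩ := aux_trim μ μ'
  obtain ⟨g, mg, g1, gν, gd⟩ := aux_trim ν ν'
  have m1 : μ' univ = γ univ := by
    rw [← h1, Measure.map_apply measurable_fst MeasurableSet.univ, preimage_univ]
  have m2 : ν' univ = γ univ := by
    rw [← h2, Measure.map_apply measurable_snd MeasurableSet.univ, preimage_univ]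
  set k : Rd d × Rd d → ℝ≥0∞ := fun q => min (f q.1) (g q.2) with hk
  have mk : Measurable k := (mf.comp measurable_fst).min (mg.comp measurable_snd)
  have hle : γ.withDensity k ≤ γ := by
    conv_rhs => rw [← withDensity_one (μ := γ)]
    exact withDensity_mono (ae_of_all _ fun q => (min_le_left _ _).trans (f1 _))
  have hfin : IsFiniteMeasure (γ.withDensity k) := isFiniteMeasure_of_le _ hle
  refine ⟨⟨γ.withDensity k, hfin⟩, ⟨?_, ?_⟩, ?_⟩
  · refine le_trans (Measure.le_iff.2 fun s hs => ?_) fμ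
    simp only [FiniteMeasure.toMeasure_mk]
    rw [Measure.map_apply measurable_fst hs, withDensity_apply _ (measurable_fst hs),
      withDensity_apply _ hs, ← h1, setLIntegral_map hs mf measurable_fst]
    exact lintegral_mono fun q => min_le_left _ _
  · refine le_trans (Measure.le_iff.2 fun s hs => ?_) gν
    simp only [FiniteMeasure.toMeasure_mk]
    rw [Measure.map_apply measurable_snd hs, withDensity_apply _ (measurable_snd hs),
      withDensity_apply _ hs, ← h2, setLIntegral_map hs mg measurable_snd]
    exact lintegral_mono fun q => min_le_right _ _
  · simp only [FiniteMeasure.toMeasure_mk]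
    have hmass : γ univ ≤ (γ.withDensity k) univ + (μ' - μ) univ + (ν' - ν) univ := by
      rw [← h1, lintegral_map (by fun_prop) measurable_fst] at fd
      rw [← h2, lintegral_map (by fun_prop) measurable_snd] at gd
      rw [h1] at fd
      rw [h2] at gd
      rw [withDensity_apply _ MeasurableSet.univ, Measure.restrict_univ]
      refine le_trans ?_ (add_le_add (add_le_add le_rfl fd) gd)
      rw [← lintegral_add_left mk, ← lintegral_add_left (by fun_prop), ← lintegral_one]
      refine lintegral_mono fun q => ?_
      rcases le_total (f q.1) (g q.2) with h | h
      · simp only [hk, min_eq_left h]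
        rw [add_tsub_cancel_of_le (f1 _)]
        exact le_self_add
      · simp only [hk, min_eq_right h]
        rw [add_right_comm, add_tsub_cancel_of_le (g1 _)]
        exact le_self_add
    have s1 : μ univ + (μ' - μ) univ = γ univ + (μ - μ') univ := by
      rw [← m1]; exact congrArg (fun m : Measure (Rd d) => m univ) (aux_sub_add μ μ')
    have s2 : ν univ + (ν' - ν) univ = γ univ + (ν - ν') univ := by
      rw [← m2]; exact congrArg (fun m : Measure (Rd d) => m univ) (aux_sub_add ν ν')
    have hD1 : (μ' - μ) univ ≠ ⊤ := ((Measure.sub_le univ).trans_lt (measure_lt_top μ' _)).ne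
    have hD2 : (ν' - ν) univ ≠ ⊤ := ((Measure.sub_le univ).trans_lt (measure_lt_top ν' _)).ne
    unfold aux_J
    refine add_le_add ?_ ?_
    · gcongr
      rw [tsub_le_iff_right, tv, tv]
      refine (ENNReal.add_le_add_iff_right (ENNReal.add_ne_top.2 ⟨hD1, hD2⟩)).1 ?_
      calc μ univ + ν univ + ((μ' - μ) univ + (ν' - ν) univ)
          = (μ univ + (μ' - μ) univ) + (ν univ + (ν' - ν) univ) := by ring
        _ = (γ univ + (μ - μ') univ) + (γ univ + (ν - ν') univ) := by rw [s1, s2]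
        _ ≤ ((γ.withDensity k) univ + (μ' - μ) univ + (ν' - ν) univ + (μ - μ') univ) +
          ((γ.withDensity k) univ + (μ' - μ) univ + (ν' - ν) univ + (ν - ν') univ) := by gcongr
        _ = _ := by ring
    · refine mul_le_mul' le_rfl (mul_le_mul' ?_ ?_)
      · exact ENNReal.rpow_le_rpow (hle univ) (sub_nonneg.2 hp)
      · exact lintegral_mono' hle le_rfl

end Main

/-- the infimum defining `T_p^{a,b}` is attained by some `μ̃ ≤ μ`, `ν̃ ≤ ν`
of equal mass. -/
theorem Tab_inf_attained {d : ℕ} (a b p : ℝ) (ha : 0 < a) (hb : 0 < b) (hp : 1 ≤ p)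
    (μ ν : Measure (Rd d)) (hμ : finMom p μ) (hν : finMom p ν) :
    ∃ μ' ν' : Measure (Rd d), μ' ≤ μ ∧ ν' ≤ ν ∧ μ' Set.univ = ν' Set.univ ∧
      ENNReal.ofReal a ^ p * (tv μ μ' + tv ν ν') ^ p + ENNReal.ofReal b ^ p * Wp p μ' ν' ^ p
        = Tab a b p μ ν := by
  have hp0 : 0 < p := by linarith
  have := hμ.1
  have := hν.1
  set A := ENNReal.ofReal a ^ p with hA
  set B := ENNReal.ofReal b ^ p with hB
  have hAt : A ≠ ⊤ := ENNReal.rpow_ne_top_of_nonneg hp0.le ENNReal.ofReal_ne_top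
  have hBt : B ≠ ⊤ := ENNReal.rpow_ne_top_of_nonneg hp0.le ENNReal.ofReal_ne_top
  have hB0 : B ≠ 0 := by
    rw [hB]
    exact (ENNReal.rpow_pos (ENNReal.ofReal_pos.2 hb) ENNReal.ofReal_ne_top).ne'
  have h0 : (0 : FiniteMeasure (Rd d × Rd d)) ∈ aux_K μ ν := by
    constructor <;> simp [Measure.zero_le]
  obtain ⟨γ, hγ, hmin⟩ := LowerSemicontinuousOn.exists_isMinOn ⟨0, h0⟩ (aux_compact μ ν)
    ((aux_lsc (d := d) A B (μ univ + ν univ) hAt hBt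
      (ENNReal.add_ne_top.2 ⟨measure_ne_top _ _, measure_ne_top _ _⟩) p hp).lowerSemicontinuousOn _)
  set G : Measure (Rd d × Rd d) := (γ : Measure (Rd d × Rd d)) with hG
  have hmass : G.map Prod.fst univ = G.map Prod.snd univ := by
    rw [Measure.map_apply measurable_fst MeasurableSet.univ,
      Measure.map_apply measurable_snd MeasurableSet.univ, preimage_univ, preimage_univ]
  refine ⟨G.map Prod.fst, G.map Prod.snd, hγ.1, hγ.2, hmass, le_antisymm ?_ ?_⟩
  · refine (aux_upper A B p hp μ ν G hγ.1 hγ.2).trans ?_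
    refine le_iInf fun μ' => le_iInf fun ν' => le_iInf fun hμ' => le_iInf fun hν' =>
      le_iInf fun hm => ?_
    rw [← hA, ← hB]
    by_cases hz : μ' univ = 0
    · have z1 : μ' = 0 := Measure.measure_univ_eq_zero.1 hz
      have z2 : ν' = 0 := Measure.measure_univ_eq_zero.1 (hm ▸ hz)
      obtain ⟨γ', hγ', hle⟩ := aux_lower A B p hp μ ν μ' ν' 0 (by simp [z1]) (by simp [z2])
      refine (hmin hγ').trans (hle.trans ?_)
      simp [planCost]
    · have hmt : μ' univ ≠ ⊤ := measure_ne_top _ _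
      have hmp0 : μ' univ ^ p ≠ 0 := by
        simp [ENNReal.rpow_eq_zero_iff, hz, hmt]
      have hmpt : μ' univ ^ p ≠ ⊤ := ENNReal.rpow_ne_top_of_nonneg hp0.le hmt
      rw [Wp, ENNReal.mul_rpow_of_nonneg _ _ hp0.le, ← ENNReal.rpow_mul, one_div,
        inv_mul_cancel₀ hp0.ne', ENNReal.rpow_one, ENNReal.mul_iInf_of_ne hmp0 hmpt,
        ENNReal.mul_iInf_of_ne hB0 hBt, ENNReal.add_iInf]
      refine le_iInf fun ⟨π, hπ⟩ => ?_
      have := hπ.1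
      have hfin : IsFiniteMeasure (μ' univ • π) := ⟨by
        simpa using hmt.lt_top⟩
      obtain ⟨γ', hγ', hle⟩ := aux_lower A B p hp μ ν μ' ν' (μ' univ • π)
        (by rw [Measure.map_smul, hπ.2.1, smul_smul, ENNReal.mul_inv_cancel hz hmt, one_smul])
        (by rw [Measure.map_smul, hπ.2.2, smul_smul, hm, ENNReal.mul_inv_cancel (hm ▸ hz)
          (measure_ne_top _ _), one_smul])
      refine (hmin hγ').trans (hle.trans (le_of_eq ?_))
      have e1 : (μ' univ • π) univ = μ' univ := by simp
      have e2 : planCost p (μ' univ • π) = μ' univ * planCost p π := by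
        simp [planCost, lintegral_smul_measure]
      rw [e1, e2, ← mul_assoc (μ' univ ^ (p - 1))]
      congr 3
      rw [ENNReal.rpow_sub _ _ hz hmt, ENNReal.rpow_one, ENNReal.div_mul_cancel hz hmt]
  · have f1 : IsFiniteMeasure (G.map Prod.fst) := inferInstance
    have f2 : IsFiniteMeasure (G.map Prod.snd) := inferInstance
    exact iInf_le_of_le _ (iInf_le_of_le _ (iInf_le_of_le f1 (iInf_le_of_le f2
      (iInf_le_of_le hmass le_rfl))))
end
end

section
/- The functional W_p^{a,b}(μ,ν) := (T_p^{a,b}(μ,ν))^{1/p}, where T_p^{a,b}(μ,ν) = inf_{μ̃,ν̃, |μ̃|=|ν̃|} a^p(|μ−μ̃|+|ν−ν̃|)^p + b^p W_p^p(μ̃,ν̃), is a metric on the space 𝓜 of positive finite Borel measures on ℝ^d (with finite p-th moment): it is symmetric, vanishes exactly when μ = ν, and satisfies the triangle inequality. -/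
open MeasureTheory Set
open scoped ENNReal NNReal

noncomputable section

/- Auxiliary material -/

theorem aux_le_sub_add {α : Type*} [MeasurableSpace α] (μ ν : Measure α) [IsFiniteMeasure μ]
    [IsFiniteMeasure ν] : μ ≤ (μ - ν) + ν :=
  Measure.sub_le_iff_le_add.1 le_rfl

theorem aux_tv_comm {d : ℕ} (μ ν : Measure (Rd d)) : tv μ ν = tv ν μ := by
  unfold tv; rw [add_comm]

theorem aux_sub_tri {α : Type*} [MeasurableSpace α] (μ ν ρ : Measure α) [IsFiniteMeasure μ]
    [IsFiniteMeasure ν] [IsFiniteMeasure ρ] : μ - ρ ≤ (μ - ν) + (ν - ρ) := by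
  apply Measure.sub_le_of_le_add
  rw [add_assoc]
  exact (aux_le_sub_add μ ν).trans (by gcongr; exact aux_le_sub_add ν ρ)

theorem aux_tv_tri {d : ℕ} (μ ν ρ : Measure (Rd d)) [IsFiniteMeasure μ]
    [IsFiniteMeasure ν] [IsFiniteMeasure ρ] : tv μ ρ ≤ tv μ ν + tv ν ρ := by
  have h1 := aux_sub_tri μ ν ρ Set.univ
  have h2 := aux_sub_tri ρ ν μ Set.univ
  simp only [Measure.add_apply] at h1 h2
  unfold tv
  calc _ ≤ _ := add_le_add h1 h2
    _ = _ := by ring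

/-- common part of two measures -/
theorem aux_inf {α : Type*} [MeasurableSpace α] (μ ν : Measure α) [IsFiniteMeasure μ]
    [IsFiniteMeasure ν] : ∃ κ : Measure α, κ ≤ μ ∧ κ ≤ ν ∧ μ - κ ≤ μ - ν ∧ ν - κ ≤ ν - μ := by
  obtain ⟨s, hs⟩ := exists_isHahnDecomposition μ ν
  have key : ∀ (ρ : Measure α), ρ = ρ.restrict s + ρ.restrict sᶜ := fun ρ =>
    (Measure.restrict_add_restrict_compl hs.measurableSet).symm
  refine ⟨μ.restrict s + ν.restrict sᶜ, ?_, ?_, ?_, ?_⟩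
  · conv_rhs => rw [key μ]
    exact add_le_add le_rfl hs.ge_on_compl
  · conv_rhs => rw [key ν]
    exact add_le_add hs.le_on le_rfl
  · apply Measure.sub_le_of_le_add
    have h := Measure.restrict_mono (le_refl sᶜ) (aux_le_sub_add μ ν)
    rw [Measure.restrict_add] at h
    calc μ = μ.restrict s + μ.restrict sᶜ := key μ
      _ ≤ μ.restrict s + ((μ - ν).restrict sᶜ + ν.restrict sᶜ) := by gcongr
      _ ≤ μ.restrict s + ((μ - ν) + ν.restrict sᶜ) := by
        gcongr; exact Measure.restrict_le_self
      _ = _ := by rw [add_left_comm]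
  · apply Measure.sub_le_of_le_add
    have h := Measure.restrict_mono (le_refl s) (aux_le_sub_add ν μ)
    rw [Measure.restrict_add] at h
    calc ν = ν.restrict s + ν.restrict sᶜ := key ν
      _ ≤ ((ν - μ).restrict s + μ.restrict s) + ν.restrict sᶜ := by gcongr
      _ ≤ ((ν - μ) + μ.restrict s) + ν.restrict sᶜ := by
        gcongr; exact Measure.restrict_le_self
      _ = _ := by rw [add_assoc]

/-- unnormalised transport cost of a finite measure on the product -/
def auxV {d : ℕ} (p : ℝ) (γ : Measure (Rd d × Rd d)) : ℝ≥0∞ :=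
  γ Set.univ ^ (1 - 1/p) * planCost p γ ^ (1/p)

def auxG {d : ℕ} (a b p : ℝ) (μ ν : Measure (Rd d)) (γ : Measure (Rd d × Rd d)) : ℝ≥0∞ :=
  ((ENNReal.ofReal a * (tv μ γ.fst + tv ν γ.snd)) ^ p
    + (ENNReal.ofReal b * auxV p γ) ^ p) ^ (1/p)

theorem aux_planCost_smul {d : ℕ} (p : ℝ) (c : ℝ≥0∞) (π : Measure (Rd d × Rd d)) :
    planCost p (c • π) = c * planCost p π := by
  simp [planCost, lintegral_smul_measure]

theorem aux_V_pow {d : ℕ} {p : ℝ} (hp : 1 ≤ p) (m : ℝ≥0∞) (hm0 : m ≠ 0) (hm : m ≠ ⊤)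
    (π : Measure (Rd d × Rd d)) [IsProbabilityMeasure π] :
    auxV p (m • π) = m * planCost p π ^ (1/p) := by
  have hp0 : 0 < p := by linarith
  unfold auxV
  rw [aux_planCost_smul, ENNReal.mul_rpow_of_nonneg _ _ (by positivity), ← mul_assoc]
  congr 1
  simp only [Measure.smul_apply, measure_univ, smul_eq_mul, mul_one]
  rw [← ENNReal.rpow_add _ _ hm0 hm]
  simp

theorem aux_Wab_le {d : ℕ} (a b : ℝ) {p : ℝ} (hp : 1 ≤ p) (μ ν : Measure (Rd d))
    (γ : Measure (Rd d × Rd d)) [IsFiniteMeasure γ] : Wab a b p μ ν ≤ auxG a b p μ ν γ := by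
  have hp0 : 0 < p := by linarith
  unfold Wab auxG
  gcongr
  unfold Tab
  refine iInf_le_of_le γ.fst (iInf_le_of_le γ.snd (iInf_le_of_le inferInstance
    (iInf_le_of_le inferInstance (iInf_le_of_le (by rw [Measure.fst_univ, Measure.snd_univ]) ?_))))
  rw [ENNReal.mul_rpow_of_nonneg _ _ hp0.le, ENNReal.mul_rpow_of_nonneg _ _ hp0.le]
  gcongr
  unfold Wp
  rcases eq_or_ne γ 0 with rfl | h0
  · simp
  have hm0 : γ Set.univ ≠ 0 := by simpa using h0
  have hm : γ Set.univ ≠ ⊤ := measure_ne_top _ _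
  have hprob : IsProbabilityMeasure ((γ Set.univ)⁻¹ • γ) :=
    ⟨by simp [ENNReal.inv_mul_cancel hm0 hm]⟩
  have hpl : IsPlan γ.fst γ.snd ((γ Set.univ)⁻¹ • γ) := by
    refine ⟨hprob, ?_, ?_⟩
    · rw [Measure.map_smul, Measure.fst_univ]; rfl
    · rw [Measure.map_smul, Measure.snd_univ]; rfl
  have e : γ = γ Set.univ • ((γ Set.univ)⁻¹ • γ) := by
    rw [smul_smul, ENNReal.mul_inv_cancel hm0 hm, one_smul]
  conv_rhs => rw [e]
  rw [aux_V_pow hp _ hm0 hm, Measure.fst_univ]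
  gcongr
  exact iInf_le_of_le ⟨_, hpl⟩ le_rfl

theorem aux_le_Wab {d : ℕ} {a b p : ℝ} (hb : 0 < b) (hp : 1 ≤ p) (μ ν : Measure (Rd d))
    (c : ℝ≥0∞) (hc : ∀ γ : Measure (Rd d × Rd d), IsFiniteMeasure γ → c ≤ auxG a b p μ ν γ) :
    c ≤ Wab a b p μ ν := by
  have hp0 : 0 < p := by linarith
  have hc' : ∀ γ : Measure (Rd d × Rd d), IsFiniteMeasure γ →
      c ^ p ≤ ENNReal.ofReal a ^ p * (tv μ γ.fst + tv ν γ.snd) ^ p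
        + ENNReal.ofReal b ^ p * auxV p γ ^ p := by
    intro γ hγ
    have := hc γ hγ
    rwa [auxG, one_div, ENNReal.le_rpow_inv_iff hp0, ENNReal.mul_rpow_of_nonneg _ _ hp0.le,
      ENNReal.mul_rpow_of_nonneg _ _ hp0.le] at this
  rw [Wab, one_div, ENNReal.le_rpow_inv_iff hp0, Tab]
  refine le_iInf fun μ' => le_iInf fun ν' => le_iInf fun h1 => le_iInf fun h2 => le_iInf fun hm => ?_
  rcases eq_or_ne (μ' Set.univ) 0 with h0 | h0
  · have e1 : μ' = 0 := by simpa using h0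
    have e2 : ν' = 0 := by rw [h0] at hm; simpa using hm.symm
    subst e1 e2
    refine (hc' 0 inferInstance).trans ?_
    have : auxV p (0 : Measure (Rd d × Rd d)) = 0 := by
      simp [auxV, planCost, hp0]
    rw [this]
    simp [hp0, Measure.fst, Measure.snd]
  have hfin : μ' Set.univ ≠ ⊤ := measure_ne_top _ _
  have hB : ENNReal.ofReal b ^ p ≠ 0 := by
    simp [ENNReal.rpow_eq_zero_iff, hb, hp0]
  have hBt : ENNReal.ofReal b ^ p ≠ ⊤ := by
    simp [ENNReal.rpow_eq_top_iff, hp0, hp0.le]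
  have hM : (μ' Set.univ) ^ p ≠ 0 := by
    simp only [ne_eq, ENNReal.rpow_eq_zero_iff]; push Not; simp [h0, hp0.le, hfin]
  have hMt : (μ' Set.univ) ^ p ≠ ⊤ := by
    exact ENNReal.rpow_ne_top_of_nonneg hp0.le hfin
  rw [Wp, ENNReal.mul_rpow_of_nonneg _ _ hp0.le, ← ENNReal.rpow_mul, one_div,
    inv_mul_cancel₀ hp0.ne', ENNReal.rpow_one, ENNReal.mul_iInf_of_ne hM hMt,
    ENNReal.mul_iInf_of_ne hB hBt, ENNReal.add_iInf]
  refine le_iInf fun ⟨π, hπ⟩ => ?_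
  have := hπ.1
  have h := hc' (μ' Set.univ • π) ⟨by simp [hfin.lt_top]⟩
  rw [aux_V_pow hp _ h0 hfin, ENNReal.mul_rpow_of_nonneg _ _ hp0.le, ← ENNReal.rpow_mul, one_div,
    inv_mul_cancel₀ hp0.ne', ENNReal.rpow_one] at h
  have e1 : (μ' Set.univ • π).fst = μ' := by
    rw [Measure.fst, Measure.map_smul, hπ.2.1, smul_smul, ENNReal.mul_inv_cancel h0 hfin, one_smul]
  have e2 : (μ' Set.univ • π).snd = ν' := by
    rw [Measure.snd, Measure.map_smul, hπ.2.2, smul_smul, hm,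
      ENNReal.mul_inv_cancel (hm ▸ h0) (hm ▸ hfin), one_smul]
  rwa [e1, e2] at h

/-- restricting a plan to a smaller second marginal -/
theorem aux_subplan {d : ℕ} (γ : Measure (Rd d × Rd d)) [IsFiniteMeasure γ]
    (κ : Measure (Rd d)) (hκ : κ ≤ γ.snd) : ∃ γ' : Measure (Rd d × Rd d), γ' ≤ γ ∧ γ'.snd = κ := by
  have : IsFiniteMeasure κ := isFiniteMeasure_of_le _ hκ
  set h := κ.rnDeriv γ.snd with hh
  have hmeas : Measurable h := Measure.measurable_rnDeriv _ _
  refine ⟨γ.withDensity (h ∘ Prod.snd), ?_, ?_⟩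
  · have h1 : h ≤ᵐ[γ.snd] 1 := Measure.rnDeriv_le_one_of_le hκ
    have h2 : (h ∘ Prod.snd) ≤ᵐ[γ] 1 := by
      have := ae_of_ae_map (f := Prod.snd) measurable_snd.aemeasurable h1
      filter_upwards [this] with x hx using hx
    calc γ.withDensity (h ∘ Prod.snd) ≤ γ.withDensity 1 := withDensity_mono h2
      _ = γ := withDensity_one
  · have := Measure.haveLebesgueDecomposition_of_sigmaFinite κ γ.snd
    have e := Measure.withDensity_rnDeriv_eq κ γ.snd hκ.absolutelyContinuous
    rw [← hh] at e
    conv_rhs => rw [← e]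
    clear_value h
    ext s hs
    rw [Measure.snd_apply hs, withDensity_apply _ (measurable_snd hs), withDensity_apply _ hs,
      Measure.snd, setLIntegral_map hs hmeas measurable_snd]
    rfl

theorem aux_V_mono {d : ℕ} {p : ℝ} (hp : 1 ≤ p) {γ γ' : Measure (Rd d × Rd d)} (h : γ' ≤ γ) :
    auxV p γ' ≤ auxV p γ := by
  have hp0 : 0 < p := by linarith
  have : 0 ≤ 1 - 1/p := by
    rw [sub_nonneg, div_le_one hp0]; exact hp
  unfold auxV planCost
  gcongr

/-- mass loss on the first marginal equals the one on the second -/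
theorem aux_fst_loss {d : ℕ} {γ γ' : Measure (Rd d × Rd d)} [IsFiniteMeasure γ] (h : γ' ≤ γ) :
    tv γ.fst γ'.fst = (γ.snd - γ'.snd) Set.univ := by
  have : IsFiniteMeasure γ' := isFiniteMeasure_of_le _ h
  have h1 : γ'.fst ≤ γ.fst := Measure.map_mono h measurable_fst
  have h2 : γ'.snd ≤ γ.snd := Measure.map_mono h measurable_snd
  rw [tv, Measure.sub_eq_zero_of_le h1, Measure.sub_apply MeasurableSet.univ h1,
    Measure.sub_apply MeasurableSet.univ h2, Measure.fst_univ, Measure.fst_univ,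
    Measure.snd_univ, Measure.snd_univ]
  simp

open ProbabilityTheory in
/-- gluing -/
theorem aux_glue {d : ℕ} {p : ℝ} (hp : 1 ≤ p) (γ₁ γ₂ : Measure (Rd d × Rd d)) [IsFiniteMeasure γ₁]
    [IsFiniteMeasure γ₂] (h : γ₁.snd = γ₂.fst) : ∃ γ : Measure (Rd d × Rd d), IsFiniteMeasure γ ∧
      γ.fst = γ₁.fst ∧ γ.snd = γ₂.snd ∧ auxV p γ ≤ auxV p γ₁ + auxV p γ₂ := by
  have hp0 : 0 < p := by linarith
  set k : Kernel (Rd d) (Rd d) := γ₂.condKernel with hk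
  set τ : Measure ((Rd d × Rd d) × Rd d) := γ₁ ⊗ₘ (k.comap Prod.snd measurable_snd) with hτ
  have t1 : τ.map Prod.fst = γ₁ := Measure.fst_compProd _ _
  have m2 : Measurable (fun q : (Rd d × Rd d) × Rd d => (q.1.2, q.2)) := by fun_prop
  have m3 : Measurable (fun q : (Rd d × Rd d) × Rd d => (q.1.1, q.2)) := by fun_prop
  have t2 : τ.map (fun q => (q.1.2, q.2)) = γ₂ := by
    conv_rhs => rw [← γ₂.disintegrate γ₂.condKernel, ← h, ← hk]
    ext s hs
    rw [Measure.map_apply m2 hs, Measure.compProd_apply (m2 hs), Measure.compProd_apply hs,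
      Measure.snd, lintegral_map (Kernel.measurable_kernel_prodMk_left hs) measurable_snd]
    rfl
  have u1 : γ₁ Set.univ = τ Set.univ := by
    rw [← t1, Measure.map_apply measurable_fst MeasurableSet.univ]; simp
  have u2 : γ₂ Set.univ = τ Set.univ := by
    rw [← t2, Measure.map_apply m2 MeasurableSet.univ]; simp
  have hme : Measurable (fun q : Rd d × Rd d => edist q.1 q.2 ^ p) := by fun_prop
  refine ⟨τ.map (fun q => (q.1.1, q.2)), inferInstance, ?_, ?_, ?_⟩
  · conv_rhs => rw [← t1]
    rw [Measure.fst, Measure.fst, Measure.map_map measurable_fst m3,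
      Measure.map_map measurable_fst measurable_fst]
    rfl
  · conv_rhs => rw [← t2]
    rw [Measure.snd, Measure.snd, Measure.map_map measurable_snd m3,
      Measure.map_map measurable_snd m2]
    rfl
  · have u3 : (τ.map (fun q : (Rd d × Rd d) × Rd d => (q.1.1, q.2))) Set.univ = τ Set.univ := by
      rw [Measure.map_apply m3 MeasurableSet.univ]; simp
    have c1 : planCost p γ₁ = ∫⁻ q, edist q.1.1 q.1.2 ^ p ∂τ := by
      conv_lhs => rw [← t1]
      rw [planCost, lintegral_map hme measurable_fst]
    have c2 : planCost p γ₂ = ∫⁻ q, edist q.1.2 q.2 ^ p ∂τ := by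
      conv_lhs => rw [← t2]
      rw [planCost, lintegral_map hme m2]
    unfold auxV
    rw [u1, u2, u3, ← mul_add, c1, c2, planCost, lintegral_map hme m3]
    gcongr
    refine le_trans ?_ (ENNReal.lintegral_Lp_add_le (μ := τ)
      (f := fun q => edist q.1.1 q.1.2) (g := fun q => edist q.1.2 q.2)
      (by fun_prop) (by fun_prop) hp)
    gcongr
    exact edist_triangle _ _ _

theorem aux_fst_swap {d : ℕ} (γ : Measure (Rd d × Rd d)) : (γ.map Prod.swap).fst = γ.snd := by
  rw [Measure.fst_map_swap]

theorem aux_snd_swap {d : ℕ} (γ : Measure (Rd d × Rd d)) : (γ.map Prod.swap).snd = γ.fst := by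
  rw [Measure.snd_map_swap]

theorem aux_V_swap {d : ℕ} (p : ℝ) (γ : Measure (Rd d × Rd d)) :
    auxV p (γ.map Prod.swap) = auxV p γ := by
  unfold auxV planCost
  rw [Measure.map_apply measurable_swap MeasurableSet.univ,
    lintegral_map (by fun_prop) measurable_swap]
  simp [edist_comm]

theorem aux_symm_le {d : ℕ} {a b p : ℝ} (hb : 0 < b) (hp : 1 ≤ p) (μ ν : Measure (Rd d)) :
    Wab a b p μ ν ≤ Wab a b p ν μ := by
  refine aux_le_Wab hb hp _ _ _ fun γ hγ => ?_
  refine (aux_Wab_le a b hp μ ν (γ.map Prod.swap)).trans ?_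
  unfold auxG
  rw [aux_fst_swap, aux_snd_swap, aux_V_swap, add_comm (tv μ _)]

/-- two-term Minkowski -/
theorem aux_mink {p : ℝ} (hp : 1 ≤ p) (x y u v : ℝ≥0∞) :
    ((x + u) ^ p + (y + v) ^ p) ^ (1/p) ≤ (x ^ p + y ^ p) ^ (1/p) + (u ^ p + v ^ p) ^ (1/p) := by
  have := ENNReal.Lp_add_le (Finset.univ : Finset (Fin 2)) (f := ![x, y]) (g := ![u, v]) hp
  simpa [Fin.sum_univ_two] using this

theorem aux_tri {d : ℕ} {a b p : ℝ} (hb : 0 < b) (hp : 1 ≤ p)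
    (μ ν ρ : Measure (Rd d)) [IsFiniteMeasure μ] [IsFiniteMeasure ν] [IsFiniteMeasure ρ]
    (γ₁ γ₂ : Measure (Rd d × Rd d)) [IsFiniteMeasure γ₁] [IsFiniteMeasure γ₂] :
    Wab a b p μ ρ ≤ auxG a b p μ ν γ₁ + auxG a b p ν ρ γ₂ := by
  have hp0 : 0 < p := by linarith
  obtain ⟨κ, k1, k2, k3, k4⟩ := aux_inf γ₁.snd γ₂.fst
  obtain ⟨γ₁', l1, s1⟩ := aux_subplan γ₁ κ k1
  obtain ⟨γ₂', l2, s2⟩ := aux_subplan (γ₂.map Prod.swap) κ (by rwa [aux_snd_swap])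
  have i1 : IsFiniteMeasure γ₁' := isFiniteMeasure_of_le _ l1
  have i2 : IsFiniteMeasure γ₂' := isFiniteMeasure_of_le _ l2
  obtain ⟨γ, i, f1, f2, hV⟩ := aux_glue hp γ₁' (γ₂'.map Prod.swap) (by rw [aux_fst_swap, s1, s2])
  rw [aux_V_swap] at hV
  rw [aux_snd_swap] at f2
  have hV' : auxV p γ ≤ auxV p γ₁ + auxV p γ₂ := by
    refine hV.trans (add_le_add (aux_V_mono hp l1) ?_)
    rw [← aux_V_swap p γ₂]
    exact aux_V_mono hp l2
  have q1 := aux_fst_loss l1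
  have q2 := aux_fst_loss l2
  rw [s1] at q1
  rw [s2, aux_fst_swap, aux_snd_swap] at q2
  have q12 : tv γ₁.fst γ₁'.fst + tv γ₂.snd γ₂'.fst ≤ tv γ₁.snd γ₂.fst := by
    rw [q1, q2]; exact add_le_add (k3 _) (k4 _)
  have hT : tv μ γ.fst + tv ρ γ.snd
      ≤ (tv μ γ₁.fst + tv ν γ₁.snd) + (tv ν γ₂.fst + tv ρ γ₂.snd) := by
    rw [f1, f2]
    have r1 := aux_tv_tri μ γ₁.fst γ₁'.fst
    have r2 := aux_tv_tri ρ γ₂.snd γ₂'.fst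
    have r3 := aux_tv_tri γ₁.snd ν γ₂.fst
    rw [aux_tv_comm γ₁.snd ν] at r3
    calc _ ≤ (tv μ γ₁.fst + tv γ₁.fst γ₁'.fst) + (tv ρ γ₂.snd + tv γ₂.snd γ₂'.fst) :=
          add_le_add r1 r2
      _ = (tv μ γ₁.fst + tv ρ γ₂.snd) + (tv γ₁.fst γ₁'.fst + tv γ₂.snd γ₂'.fst) := by ring
      _ ≤ (tv μ γ₁.fst + tv ρ γ₂.snd) + (tv ν γ₁.snd + tv ν γ₂.fst) := by
          exact add_le_add le_rfl (q12.trans r3)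
      _ = _ := by ring
  refine (aux_Wab_le a b hp μ ρ γ).trans (le_trans ?_ (aux_mink hp _ _ _ _))
  unfold auxG
  rw [← mul_add, ← mul_add]
  gcongr

theorem aux_int_V {d : ℕ} {p : ℝ} (hp : 1 ≤ p) (γ : Measure (Rd d × Rd d)) :
    ∫⁻ q, edist q.1 q.2 ∂γ ≤ auxV p γ := by
  have h := eLpNorm'_le_eLpNorm'_mul_rpow_measure_univ (μ := γ)
    (f := fun q : Rd d × Rd d => dist q.1 q.2) one_pos hp (by fun_prop)
  have e : ∀ q : Rd d × Rd d, ‖dist q.1 q.2‖ₑ = edist q.1 q.2 := fun q => by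
    rw [Real.enorm_eq_ofReal dist_nonneg, edist_dist]
  simp only [eLpNorm', e, ENNReal.rpow_one, div_one] at h
  rw [mul_comm] at h
  exact h

theorem aux_lint_tv {d : ℕ} (μ ν : Measure (Rd d)) [IsFiniteMeasure μ] [IsFiniteMeasure ν]
    (f : Rd d → ℝ≥0∞) (hf : ∀ x, f x ≤ 1) : ∫⁻ x, f x ∂μ ≤ ∫⁻ x, f x ∂ν + tv μ ν := by
  calc ∫⁻ x, f x ∂μ ≤ ∫⁻ x, f x ∂((μ - ν) + ν) := lintegral_mono' (aux_le_sub_add μ ν) le_rfl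
    _ = ∫⁻ x, f x ∂(μ - ν) + ∫⁻ x, f x ∂ν := lintegral_add_measure _ _ _
    _ ≤ ∫⁻ x, 1 ∂(μ - ν) + ∫⁻ x, f x ∂ν := by gcongr; exact hf _
    _ ≤ ∫⁻ x, f x ∂ν + tv μ ν := by
      rw [lintegral_one, add_comm, tv]; gcongr; exact le_self_add

theorem aux_int_le {d : ℕ} {a b p : ℝ} (ha : 0 < a) (hb : 0 < b) (hp : 1 ≤ p)
    (μ ν : Measure (Rd d)) [IsFiniteMeasure μ] [IsFiniteMeasure ν] (h0 : Wab a b p μ ν = 0)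
    (f : Rd d → ℝ≥0) (K : ℝ≥0) (hf : ∀ x, f x ≤ 1) (hK : LipschitzWith K f) :
    ∫⁻ x, f x ∂μ ≤ ∫⁻ x, f x ∂ν := by
  have hp0 : 0 < p := by linarith
  set A := ENNReal.ofReal a with hA
  set B := ENNReal.ofReal b with hB
  have hA0 : A ≠ 0 := by simp [hA, ha]
  have hB0 : B ≠ 0 := by simp [hB, hb]
  have hAt : A ≠ ⊤ := by simp [hA]
  have hBt : B ≠ ⊤ := by simp [hB]
  have hmf : Measurable f := hK.continuous.measurable
  -- the constant
  set C : ℝ≥0∞ := A⁻¹ + K * B⁻¹ with hC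
  have hCt : C ≠ ⊤ := by
    simp [hC, hA0, hB0, ENNReal.mul_eq_top]
  have hCn : C ≠ 0 := by simp [hC, hAt]
  have main : ∀ γ : Measure (Rd d × Rd d), IsFiniteMeasure γ →
      ∫⁻ x, f x ∂μ ≤ ∫⁻ x, f x ∂ν + C * auxG a b p μ ν γ := by
    intro γ hγ
    have g1 : tv μ γ.fst + tv ν γ.snd ≤ A⁻¹ * auxG a b p μ ν γ := by
      rw [mul_comm, ← div_eq_mul_inv, ENNReal.le_div_iff_mul_le (.inl hA0) (.inl hAt), mul_comm,
        auxG, one_div, ENNReal.le_rpow_inv_iff hp0]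
      exact le_self_add
    have g2 : auxV p γ ≤ B⁻¹ * auxG a b p μ ν γ := by
      rw [mul_comm, ← div_eq_mul_inv, ENNReal.le_div_iff_mul_le (.inl hB0) (.inl hBt), mul_comm,
        auxG, one_div, ENNReal.le_rpow_inv_iff hp0]
      exact le_add_self
    have s1 := aux_lint_tv μ γ.fst (fun x => f x) (fun x => by exact_mod_cast hf x)
    have s3 := aux_lint_tv γ.snd ν (fun x => f x) (fun x => by exact_mod_cast hf x)
    have s2 : ∫⁻ x, f x ∂γ.fst ≤ ∫⁻ x, f x ∂γ.snd + K * auxV p γ := by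
      rw [Measure.fst, Measure.snd, lintegral_map (by fun_prop) measurable_fst,
        lintegral_map (by fun_prop) measurable_snd]
      calc ∫⁻ q, (f q.1 : ℝ≥0∞) ∂γ ≤ ∫⁻ q, ((f q.2 : ℝ≥0∞) + K * edist q.1 q.2) ∂γ := by
            gcongr with q
            have := hK q.1 q.2
            refine le_trans ?_ (add_le_add le_rfl this)
            rw [edist_nndist, ← ENNReal.coe_add, ENNReal.coe_le_coe, NNReal.nndist_eq]
            refine le_trans ?_ (add_le_add le_rfl (le_max_left _ _))
            exact le_add_tsub
        _ = ∫⁻ q, (f q.2 : ℝ≥0∞) ∂γ + K * ∫⁻ q, edist q.1 q.2 ∂γ := by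
            rw [lintegral_add_left (by fun_prop), lintegral_const_mul _ (by fun_prop)]
        _ ≤ _ := by gcongr; exact aux_int_V hp γ
    rw [aux_tv_comm] at s3
    calc ∫⁻ x, f x ∂μ ≤ ((∫⁻ x, f x ∂ν + tv ν γ.snd) + K * auxV p γ) + tv μ γ.fst :=
          s1.trans (add_le_add (s2.trans (add_le_add s3 le_rfl)) le_rfl)
      _ = ∫⁻ x, f x ∂ν + ((tv μ γ.fst + tv ν γ.snd) + K * auxV p γ) := by ring
      _ ≤ ∫⁻ x, f x ∂ν + (A⁻¹ * auxG a b p μ ν γ + K * (B⁻¹ * auxG a b p μ ν γ)) := by gcongr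
      _ = _ := by rw [hC]; ring
  have : (∫⁻ x, f x ∂μ - ∫⁻ x, f x ∂ν) / C ≤ Wab a b p μ ν := by
    refine aux_le_Wab hb hp _ _ _ fun γ hγ => ?_
    rw [ENNReal.div_le_iff hCn hCt, tsub_le_iff_left, mul_comm]
    exact main γ hγ
  rw [h0, ENNReal.div_le_iff hCn hCt, zero_mul, tsub_le_iff_left, add_zero] at this
  exact this

theorem aux_eq {d : ℕ} {a b p : ℝ} (ha : 0 < a) (hb : 0 < b) (hp : 1 ≤ p)
    (μ ν : Measure (Rd d)) [IsFiniteMeasure μ] [IsFiniteMeasure ν] (h0 : Wab a b p μ ν = 0) :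
    μ = ν := by
  have h0' : Wab a b p ν μ = 0 := le_antisymm (h0 ▸ aux_symm_le hb hp ν μ) (by simp)
  have key : ∀ F : Set (Rd d), IsClosed F → μ F = ν F := by
    intro F hF
    have hpos : ∀ n : ℕ, (0 : ℝ) < 1 / ((n : ℝ) + 1) := fun n => by positivity
    have t1 := tendsto_lintegral_thickenedIndicator_of_isClosed μ hF hpos
      tendsto_one_div_add_atTop_nhds_zero_nat
    have t2 := tendsto_lintegral_thickenedIndicator_of_isClosed ν hF hpos
      tendsto_one_div_add_atTop_nhds_zero_nat
    refine tendsto_nhds_unique t1 (t2.congr fun n => ?_)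
    have l1 := thickenedIndicator_le_one (hpos n) F
    have l2 := lipschitzWith_thickenedIndicator (hpos n) F
    exact le_antisymm (aux_int_le ha hb hp ν μ h0' _ _ l1 l2) (aux_int_le ha hb hp μ ν h0 _ _ l1 l2)
  apply ext_of_generate_finite _ ?_ isPiSystem_isClosed
  · exact fun F hF => key F hF
  · exact key _ isClosed_univ
  · rw [BorelSpace.measurable_eq (α := Rd d), borel_eq_generateFrom_isClosed]

theorem aux_self {d : ℕ} (a b : ℝ) {p : ℝ} (hp : 1 ≤ p) (μ : Measure (Rd d)) [IsFiniteMeasure μ] :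
    Wab a b p μ μ = 0 := by
  have hp0 : 0 < p := by linarith
  have md : Measurable (fun x : Rd d => (x, x)) := by fun_prop
  have h := aux_Wab_le a b hp μ μ (μ.map (fun x => (x, x)))
  have e1 : (μ.map (fun x => (x, x))).fst = μ := by
    rw [Measure.fst, Measure.map_map measurable_fst md]; exact Measure.map_id
  have e2 : (μ.map (fun x => (x, x))).snd = μ := by
    rw [Measure.snd, Measure.map_map measurable_snd md]; exact Measure.map_id
  have e3 : auxV p (μ.map (fun x => (x, x))) = 0 := by
    rw [auxV, planCost, lintegral_map (by fun_prop) md]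
    simp [hp0]
  rw [auxG, e1, e2, e3] at h
  simpa [tv, hp0] using h

/-- `W_p^{a,b}` is a metric on the space of finite measures with finite
`p`-th moment: symmetric, vanishing exactly on the diagonal, triangle inequality. -/
theorem Wab_is_metric {d : ℕ} (a b p : ℝ) (ha : 0 < a) (hb : 0 < b) (hp : 1 ≤ p) :
    (∀ μ ν : Measure (Rd d), finMom p μ → finMom p ν → Wab a b p μ ν = Wab a b p ν μ) ∧
    (∀ μ ν : Measure (Rd d), finMom p μ → finMom p ν → (Wab a b p μ ν = 0 ↔ μ = ν)) ∧
    (∀ μ ν ρ : Measure (Rd d), finMom p μ → finMom p ν → finMom p ρ →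
      Wab a b p μ ρ ≤ Wab a b p μ ν + Wab a b p ν ρ) := by
  refine ⟨fun μ ν _ _ => le_antisymm (aux_symm_le hb hp μ ν) (aux_symm_le hb hp ν μ),
    fun μ ν hμ hν => ?_, fun μ ν ρ hμ hν hρ => ?_⟩
  · have := hμ.1
    have := hν.1
    refine ⟨aux_eq ha hb hp μ ν, ?_⟩
    rintro rfl
    exact aux_self a b hp μ
  · have := hμ.1
    have := hν.1
    have := hρ.1
    have e : ∀ μ ν : Measure (Rd d), Wab a b p μ ν
        = ⨅ γ : {γ : Measure (Rd d × Rd d) // IsFiniteMeasure γ}, auxG a b p μ ν γ.1 := by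
      intro μ ν
      apply le_antisymm
      · refine le_iInf fun γ => ?_
        have := γ.2
        exact aux_Wab_le a b hp μ ν γ.1
      · exact aux_le_Wab hb hp _ _ _ fun γ hγ => iInf_le_of_le ⟨γ, hγ⟩ le_rfl
    rw [e μ ν, e ν ρ, ENNReal.iInf_add]
    refine le_iInf fun γ₁ => ?_
    rw [ENNReal.add_iInf]
    refine le_iInf fun γ₂ => ?_
    have := γ₁.2
    have := γ₂.2
    exact aux_tri hb hp μ ν ρ γ₁.1 γ₂.1
end
end

section
/- The space 𝓜 of positive finite Borel measures on ℝ^d, endowed with the generalized Wasserstein distance W_p^{a,b}, is a complete metric space. -/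
open MeasureTheory Set
open scoped ENNReal NNReal

noncomputable section

open ProbabilityTheory Filter Topology

namespace WabAux

/-- Ionescu-Tulcea: a sequence of compatible couplings is realised by one path measure. -/
theorem exists_path_prob {E : Type} [MeasurableSpace E] [StandardBorelSpace E] [Nonempty E]
    (Q : ℕ → Measure (E × E)) (hQ : ∀ k, IsProbabilityMeasure (Q k))
    (hc : ∀ k, (Q (k+1)).map Prod.fst = (Q k).map Prod.snd) :
    ∃ P : Measure (ℕ → E), IsProbabilityMeasure P ∧
      ∀ k, P.map (fun ω => (ω k, ω (k+1))) = Q k := by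
  let κ : (n : ℕ) → Kernel (Π i : Finset.Iic n, (fun _ : ℕ => E) i) E := fun n =>
    (Q n).condKernel.comap (fun x => x ⟨n, by simp⟩) (measurable_pi_apply _)
  have hκ : ∀ n, IsMarkovKernel (κ n) := fun n => by
    dsimp only [κ]; infer_instance
  have : IsProbabilityMeasure ((Q 0).fst) := inferInstance
  let P : Measure (ℕ → E) := Kernel.trajMeasure (X := fun _ => E) (Q 0).fst κ
  have hP : IsProbabilityMeasure P := by
    dsimp only [P]; infer_instance
  have key : ∀ k, P.map (fun ω => ω k) = (Q k).fst → P.map (fun ω => (ω k, ω (k+1))) = Q k := by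
    intro k hk
    have h := Kernel.map_frestrictLe_trajMeasure_compProd_eq_map_trajMeasure
      (X := fun _ => E) (μ₀ := (Q 0).fst) (κ := κ) (a := k)
    change P.map _ ⊗ₘ κ k = P.map _ at h
    have h2 : P.map (fun ω => (ω k, ω (k+1))) =
        (P.map (fun x => (Preorder.frestrictLe (π := fun _ => E) k x, x (k+1)))).map
          (fun z => (z.1 ⟨k, by simp⟩, z.2)) := by
      rw [Measure.map_map (by fun_prop) (by fun_prop)]
      rfl
    rw [h2, ← h]
    conv_rhs => rw [← (Q k).disintegrate (Q k).condKernel, ← hk]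
    have : SFinite (P.map (fun ω : ℕ → E => ω k)) := inferInstance
    refine Measure.ext_of_lintegral _ fun f hf => ?_
    rw [lintegral_map hf (by fun_prop), Measure.lintegral_compProd (by fun_prop),
      Measure.lintegral_compProd (by fun_prop), lintegral_map _ (by fun_prop),
      lintegral_map _ (by fun_prop)]
    · rfl
    · exact Measurable.lintegral_kernel_prod_right' (κ := (Q k).condKernel) hf
    · exact Measurable.lintegral_kernel_prod_right' (κ := κ k) (f := fun z => f (z.1 ⟨k, by simp⟩, z.2)) (by fun_prop)
  have h0 : P.map (fun ω => ω 0) = (Q 0).fst := by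
    have h := Kernel.map_frestrictLe_trajMeasure_compProd_eq_map_trajMeasure
      (X := fun _ => E) (μ₀ := (Q 0).fst) (κ := κ) (a := 0)
    have h1 : P.map (Preorder.frestrictLe (π := fun _ => E) 0) =
       ((Q 0).fst).map (MeasurableEquiv.piUnique (fun i : Finset.Iic 0 => E)).symm := by
      dsimp only [P]
      rw [Kernel.trajMeasure, Measure.map_comp _ _ (by fun_prop), Kernel.traj_map_frestrictLe,
        Kernel.partialTraj_self, Measure.id_comp]
    have h2 : P.map (fun ω => ω 0) = (P.map (Preorder.frestrictLe (π := fun _ => E) 0)).map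
        (fun z => z ⟨0, by simp⟩) := by
      rw [Measure.map_map (by fun_prop) (by fun_prop)]
      rfl
    rw [h2, h1, Measure.map_map (by fun_prop) (by fun_prop)]
    exact Measure.map_id
  have hall : ∀ k, P.map (fun ω => ω k) = (Q k).fst := by
    intro k
    induction k with
    | zero => exact h0
    | succ k ih =>
      have h := key k ih
      rw [Measure.fst, hc k, ← h, Measure.map_map (by fun_prop) (by fun_prop)]
      rfl
  exact ⟨P, hP, fun k => key k (hall k)⟩

/-- Submeasures of an image measure lift. -/
theorem exists_le_map {Ω E : Type} [MeasurableSpace Ω] [MeasurableSpace E] (σ : Measure Ω)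
    [IsFiniteMeasure σ] (h : Ω → E) (hh : Measurable h) (ρ : Measure E) (hρ : ρ ≤ σ.map h) :
    ∃ σ' : Measure Ω, σ' ≤ σ ∧ σ'.map h = ρ := by
  have : IsFiniteMeasure ρ := isFiniteMeasure_of_le _ hρ
  have hac : ρ ≪ σ.map h := hρ.absolutelyContinuous
  set f := ρ.rnDeriv (σ.map h) with hf
  have hfm : Measurable f := Measure.measurable_rnDeriv _ _
  have hf1 : ∀ᵐ x ∂σ, f (h x) ≤ 1 := ae_of_ae_map hh.aemeasurable (Measure.rnDeriv_le_one_of_le hρ)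
  refine ⟨σ.withDensity (fun x => f (h x)), ?_, ?_⟩
  · calc σ.withDensity (fun x => f (h x)) ≤ σ.withDensity 1 := withDensity_mono hf1
      _ = σ := withDensity_one
  · conv_rhs => rw [← Measure.withDensity_rnDeriv_eq _ _ hac]
    ext s hs
    rw [Measure.map_apply hh hs, withDensity_apply _ (hh hs), withDensity_apply _ hs,
      setLIntegral_map hs hfm hh]

/-- Scaled `L^p` functional. -/
def NN {Ω : Type} [MeasurableSpace Ω] (p : ℝ) (Q : Measure Ω) (f : Ω → ℝ≥0∞) : ℝ≥0∞ :=
  Q univ ^ (1 - 1/p) * (∫⁻ x, f x ^ p ∂Q) ^ (1/p)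

section NN
variable {Ω : Type} [MeasurableSpace Ω] {p : ℝ} 

theorem inv_nonneg_of (hp : 1 ≤ p) : 0 ≤ 1 - 1/p := by
  have : 1/p ≤ 1 := by rw [div_le_one (by linarith)]; exact hp
  linarith

theorem NN_mono (hp : 1 ≤ p) {Q Q' : Measure Ω} (hQ : Q ≤ Q') {f g : Ω → ℝ≥0∞}
    (h : ∀ᵐ x ∂Q, f x ≤ g x) : NN p Q f ≤ NN p Q' g := by
  have h0 := inv_nonneg_of hp
  have hp0 : 0 ≤ p := by linarith
  have hp1 : 0 ≤ 1/p := by positivity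
  unfold NN
  refine mul_le_mul' (ENNReal.rpow_le_rpow (hQ _) h0) (ENNReal.rpow_le_rpow ?_ hp1)
  refine (lintegral_mono_ae ?_).trans (lintegral_mono' hQ le_rfl)
  filter_upwards [h] with x hx using ENNReal.rpow_le_rpow hx hp0

theorem NN_add (hp : 1 ≤ p) (Q : Measure Ω) {f g : Ω → ℝ≥0∞} (hf : Measurable f)
    (hg : Measurable g) : NN p Q (fun x => f x + g x) ≤ NN p Q f + NN p Q g := by
  unfold NN
  rw [← mul_add]
  exact mul_le_mul' le_rfl (ENNReal.lintegral_Lp_add_le hf.aemeasurable hg.aemeasurable hp)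

theorem NN_sum (hp : 1 ≤ p) (Q : Measure Ω) {f : ℕ → Ω → ℝ≥0∞} (hf : ∀ k, Measurable (f k))
    (n : ℕ) : NN p Q (fun x => ∑ k ∈ Finset.range n, f k x) ≤
      ∑ k ∈ Finset.range n, NN p Q (f k) := by
  induction n with
  | zero =>
    have hp0 : 0 < p := by linarith
    simp [NN, hp0]
  | succ n ih =>
    simp only [Finset.sum_range_succ]
    exact (NN_add hp Q (by fun_prop) (hf n)).trans (by gcongr)

theorem NN_tsum (hp : 1 ≤ p) (Q : Measure Ω) [IsFiniteMeasure Q] {f : ℕ → Ω → ℝ≥0∞}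
    (hf : ∀ k, Measurable (f k)) :
    NN p Q (fun x => ∑' k, f k x) ≤ ∑' k, NN p Q (f k) := by
  have hp0 : 0 < p := by linarith
  have h0 := inv_nonneg_of hp
  have hlim : Tendsto (fun n => NN p Q (fun x => ∑ k ∈ Finset.range n, f k x)) atTop
      (𝓝 (NN p Q (fun x => ∑' k, f k x))) := by
    unfold NN
    refine ENNReal.Tendsto.const_mul ?_ (Or.inr (ENNReal.rpow_ne_top_of_nonneg h0 (measure_ne_top _ _)))
    refine (ENNReal.continuous_rpow_const.tendsto _).comp ?_
    refine lintegral_tendsto_of_tendsto_of_monotone (fun n => by fun_prop) ?_ ?_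
    · refine Eventually.of_forall fun x => fun m n hmn => ?_
      exact ENNReal.rpow_le_rpow (Finset.sum_le_sum_of_subset (Finset.range_mono hmn)) hp0.le
    · refine Eventually.of_forall fun x => ?_
      exact (ENNReal.continuous_rpow_const.tendsto _).comp (ENNReal.tendsto_nat_tsum _)
  exact le_of_tendsto hlim (Eventually.of_forall fun n =>
    (NN_sum hp Q hf n).trans (ENNReal.sum_le_tsum _))

theorem lintegral_le_NN (hp : 1 ≤ p) (Q : Measure Ω) {f : Ω → ℝ≥0∞} (hf : Measurable f) :
    ∫⁻ x, f x ∂Q ≤ NN p Q f := by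
  have h := eLpNorm'_le_eLpNorm'_mul_rpow_measure_univ (p := 1) (q := p) (μ := Q) (f := f)
    one_pos hp (by exact hf.aestronglyMeasurable)
  simp only [eLpNorm', ENNReal.rpow_one, enorm_eq_self, div_one] at h
  unfold NN
  rw [mul_comm]
  exact h

theorem NN_map {E : Type} [MeasurableSpace E] (Q : Measure Ω) {h : Ω → E} (hh : Measurable h)
    {f : E → ℝ≥0∞} (hf : Measurable f) : NN p (Q.map h) f = NN p Q (fun x => f (h x)) := by
  unfold NN
  rw [Measure.map_apply hh MeasurableSet.univ, lintegral_map (by fun_prop) hh]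
  rfl
end NN

theorem exists_path {X : Type} [MeasurableSpace X] [StandardBorelSpace X] [Nonempty X]
    (μ : ℕ → Measure X) (hfin : ∀ k, IsFiniteMeasure (μ k)) (π : ℕ → Measure (X × X))
    (h1 : ∀ k, (π k).map Prod.fst ≤ μ k) (h2 : ∀ k, (π k).map Prod.snd ≤ μ (k+1))
    (M : ℝ≥0∞) (hMt : M ≠ ⊤) (hM : ∀ k, μ k univ ≤ M) :
    ∃ P : Measure (ℕ → X × Bool), IsFiniteMeasure P ∧
      (∀ k, (P.restrict {ω | (ω k).2 = true}).map (fun ω => (ω k).1) = μ k) ∧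
      ∀ k, (P.restrict {ω | (ω k).2 = true ∧ (ω (k+1)).2 = true}).map
        (fun ω => ((ω k).1, (ω (k+1)).1)) = π k := by
  have hf1 : ∀ k, IsFiniteMeasure ((π k).map Prod.fst) := fun k => isFiniteMeasure_of_le _ (h1 k)
  have hf2 : ∀ k, IsFiniteMeasure ((π k).map Prod.snd) := fun k => isFiniteMeasure_of_le _ (h2 k)
  let x0 : X := Classical.arbitrary X
  let r : X × Bool := (x0, false)
  let lam : ℕ → Measure X := fun k => μ k - (π k).map Prod.fst
  let bet : ℕ → Measure X := fun k => μ (k+1) - (π k).map Prod.snd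
  have hlam : ∀ k, lam k + (π k).map Prod.fst = μ k := fun k => Measure.sub_add_cancel_of_le (h1 k)
  have hbet : ∀ k, bet k + (π k).map Prod.snd = μ (k+1) := fun k =>
    Measure.sub_add_cancel_of_le (h2 k)
  have hlam' : ∀ k, lam k univ + π k univ = μ k univ := fun k => by
    have := congrArg (fun m => m univ) (hlam k)
    simpa [Measure.map_apply measurable_fst MeasurableSet.univ] using this
  have hbet' : ∀ k, bet k univ + π k univ = μ (k+1) univ := fun k => by
    have := congrArg (fun m => m univ) (hbet k)
    simpa [Measure.map_apply measurable_snd MeasurableSet.univ] using this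
  let M' : ℝ≥0∞ := M + M + 1
  have hM't : M' ≠ ⊤ := by simp [M', hMt]
  have hM'0 : M' ≠ 0 := by simp [M']
  let c : ℕ → ℝ≥0∞ := fun k => M' - (μ k univ + bet k univ)
  have hc : ∀ k, c k + (μ k univ + bet k univ) = M' := fun k => by
    refine tsub_add_cancel_of_le ?_
    have : bet k univ ≤ M := (le_self_add.trans (hbet' k).le).trans (hM _)
    calc μ k univ + bet k univ ≤ M + M := add_le_add (hM k) this
      _ ≤ M' := le_self_add
  let t : X → X × Bool := fun x => (x, true)
  have ht : Measurable t := by fun_prop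
  let i : X × X → (X × Bool) × (X × Bool) := fun z => (t z.1, t z.2)
  have hi : Measurable i := by fun_prop
  let j : X → (X × Bool) × (X × Bool) := fun x => (t x, r)
  have hj : Measurable j := by fun_prop
  let l : X → (X × Bool) × (X × Bool) := fun x => (r, t x)
  have hl : Measurable l := by fun_prop
  let R : ℕ → Measure ((X × Bool) × (X × Bool)) := fun k =>
    (π k).map i + (lam k).map j + (bet k).map l + c k • Measure.dirac (r, r)
  have hRfst : ∀ k, (R k).map Prod.fst =
      (μ k).map t + (M' - μ k univ) • Measure.dirac r := by
    intro k
    have e : (M' - μ k univ) = bet k univ + c k := by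
      rw [← hc k, ← add_assoc, add_comm (c k), add_assoc,
        ENNReal.add_sub_cancel_left (measure_ne_top _ _), add_comm]
    rw [e, ← hlam k]
    simp only [R]
    rw [Measure.map_add _ _ (by fun_prop), Measure.map_add _ _ (by fun_prop),
      Measure.map_add _ _ (by fun_prop), Measure.map_smul,
      Measure.map_dirac' (by fun_prop), Measure.map_map (by fun_prop) hi,
      Measure.map_map (by fun_prop) hj, Measure.map_map (by fun_prop) hl,
      Measure.map_add _ _ ht, Measure.map_map ht (by fun_prop)]
    have e2 : Prod.fst ∘ l = fun _ => r := rfl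
    rw [e2, Measure.map_const, add_smul, ← add_assoc]
    congr 2
    rw [add_comm]
    rfl
  have hRsnd : ∀ k, (R k).map Prod.snd =
      (μ (k+1)).map t + (M' - μ (k+1) univ) • Measure.dirac r := by
    intro k
    have e : (M' - μ (k+1) univ) = lam k univ + c k := by
      have : M' = μ (k+1) univ + (lam k univ + c k) := by
        rw [← hc k, ← hlam' k, ← hbet' k]; ring
      rw [this, ENNReal.add_sub_cancel_left (measure_ne_top _ _)]
    rw [e, ← hbet k]
    simp only [R]
    rw [Measure.map_add _ _ (by fun_prop), Measure.map_add _ _ (by fun_prop),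
      Measure.map_add _ _ (by fun_prop), Measure.map_smul,
      Measure.map_dirac' (by fun_prop), Measure.map_map (by fun_prop) hi,
      Measure.map_map (by fun_prop) hj, Measure.map_map (by fun_prop) hl,
      Measure.map_add _ _ ht, Measure.map_map ht (by fun_prop)]
    have e2 : Prod.snd ∘ j = fun _ => r := rfl
    have e3 : Prod.snd ∘ i = t ∘ Prod.snd := rfl
    have e4 : Prod.snd ∘ l = t := rfl
    rw [e2, e3, e4, Measure.map_const, add_smul]
    abel
  have hRuniv : ∀ k, R k univ = M' := by
    intro k
    have := congrArg (fun m => m univ) (hRfst k)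
    simp only [Measure.map_apply measurable_fst MeasurableSet.univ, Measure.add_apply,
      Measure.map_apply ht MeasurableSet.univ, preimage_univ, Measure.smul_apply,
      smul_eq_mul, measure_univ, mul_one] at this
    rw [this]
    refine add_tsub_cancel_of_le ?_
    rw [← hc k, ← add_assoc, add_comm (c k), add_assoc]
    exact le_self_add
  obtain ⟨P, hP, hPQ⟩ := exists_path_prob (fun k => M'⁻¹ • R k)
    (fun k => ⟨by simp [hRuniv, ENNReal.inv_mul_cancel hM'0 hM't]⟩)
    (fun k => by rw [Measure.map_smul, Measure.map_smul, hRfst, hRsnd])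
  have hpair : ∀ k, (M' • P).map (fun ω => (ω k, ω (k+1))) = R k := by
    intro k
    rw [Measure.map_smul, hPQ, smul_smul, ENNReal.mul_inv_cancel hM'0 hM't, one_smul]
  have hfst : ∀ k, (M' • P).map (fun ω => ω k) = (R k).map Prod.fst := by
    intro k
    rw [← hpair, Measure.map_map (by fun_prop) (by fun_prop)]
    rfl
  refine ⟨M' • P, Measure.smul_finite _ hM't, ?_, ?_⟩
  · intro k
    ext s hs
    have hA : MeasurableSet {z : X × Bool | z.1 ∈ s ∧ z.2 = true} :=
      (measurable_fst hs).inter (measurable_snd (measurableSet_singleton true))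
    have hg : Measurable (fun ω : ℕ → X × Bool => (ω k).1) := by fun_prop
    rw [Measure.map_apply hg hs, Measure.restrict_apply (hg hs)]
    have e := congrArg (fun m => m {z : X × Bool | z.1 ∈ s ∧ z.2 = true}) ((hfst k).trans (hRfst k))
    simp only [Measure.add_apply, Measure.map_apply ht hA, Measure.smul_apply _ _ {z : X × Bool | z.1 ∈ s ∧ z.2 = true}] at e
    rw [Measure.map_apply (by fun_prop) hA, Measure.dirac_apply' _ hA] at e
    simpa [t, r, preimage, inter_def] using e
  · intro k
    ext s hs
    have hA : MeasurableSet {z : (X × Bool) × (X × Bool) |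
        (z.1.1, z.2.1) ∈ s ∧ (z.1.2 = true ∧ z.2.2 = true)} := by
      refine MeasurableSet.inter ?_ (MeasurableSet.inter ?_ ?_)
      · exact (show Measurable (fun z : (X × Bool) × (X × Bool) => (z.1.1, z.2.1)) by fun_prop) hs
      · exact (show Measurable (fun z : (X × Bool) × (X × Bool) => z.1.2) by fun_prop)
          (measurableSet_singleton true)
      · exact (show Measurable (fun z : (X × Bool) × (X × Bool) => z.2.2) by fun_prop)
          (measurableSet_singleton true)
    have hg : Measurable (fun ω : ℕ → X × Bool => ((ω k).1, (ω (k+1)).1)) := by fun_prop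
    rw [Measure.map_apply hg hs, Measure.restrict_apply (hg hs)]
    have e := congrArg (fun m => m {z : (X × Bool) × (X × Bool) |
        (z.1.1, z.2.1) ∈ s ∧ (z.1.2 = true ∧ z.2.2 = true)}) (hpair k)
    simp only [R, Measure.add_apply, Measure.map_apply hi hA, Measure.map_apply hj hA,
      Measure.map_apply hl hA, Measure.smul_apply _ _ {z : (X × Bool) × (X × Bool) |
        (z.1.1, z.2.1) ∈ s ∧ (z.1.2 = true ∧ z.2.2 = true)}] at e
    rw [Measure.map_apply (by fun_prop) hA, Measure.dirac_apply' _ hA] at e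
    simpa [i, j, l, t, r, preimage, inter_def] using e

def alive {X : Type} (k : ℕ) : Set (ℕ → X × Bool) := {ω | (ω k).2 = true}

theorem measurableSet_alive {X : Type} [MeasurableSpace X] (k : ℕ) :
    MeasurableSet (alive (X := X) k) :=
  (show Measurable (fun ω : ℕ → X × Bool => (ω k).2) by fun_prop) (measurableSet_singleton true)

/-- `μ` and `ν` are `ε`-close through a sub-plan. -/
def Close {d : ℕ} (p : ℝ) (ε : ℝ≥0∞) (μ ν : Measure (Rd d)) (π : Measure (Rd d × Rd d)) : Prop :=
  π.map Prod.fst ≤ μ ∧ π.map Prod.snd ≤ ν ∧ μ univ ≤ π univ + ε ∧ ν univ ≤ π univ + ε ∧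
    NN p π (fun q => edist q.1 q.2) ≤ ε

theorem exists_path_close {d : ℕ} {p : ℝ} (hp : 1 ≤ p)
    (μ : ℕ → Measure (Rd d)) (hfin : ∀ k, IsFiniteMeasure (μ k)) (π : ℕ → Measure (Rd d × Rd d))
    (ε : ℕ → ℝ≥0∞) (hcl : ∀ k, Close p (ε k) (μ k) (μ (k+1)) (π k))
    (M : ℝ≥0∞) (hMt : M ≠ ⊤) (hM : ∀ k, μ k univ ≤ M) :
    ∃ P : Measure (ℕ → Rd d × Bool), IsFiniteMeasure P ∧
      (∀ k A, A ⊆ alive k → (P.restrict A).map (fun ω => (ω k).1) ≤ μ k) ∧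
      (∀ k, μ k univ = P (alive k)) ∧
      (∀ k, P (alive k \ alive (k+1)) ≤ ε k) ∧
      (∀ k, P (alive (k+1) \ alive k) ≤ ε k) ∧
      (∀ k A, A ⊆ alive k ∩ alive (k+1) →
        NN p (P.restrict A) (fun ω => edist (ω k).1 (ω (k+1)).1) ≤ ε k) := by
  obtain ⟨P, hP, hP1, hP2⟩ := exists_path μ hfin π (fun k => (hcl k).1) (fun k => (hcl k).2.1) M hMt hM
  have hb : ∀ k, μ k univ = P (alive k) := fun k => by
    rw [← hP1 k, Measure.map_apply (by fun_prop) MeasurableSet.univ]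
    simp [alive]
  have hpi : ∀ k, π k univ = P (alive k ∩ alive (k+1)) := fun k => by
    rw [← hP2 k, Measure.map_apply (by fun_prop) MeasurableSet.univ]
    simp [alive, inter_def]
  refine ⟨P, hP, ?_, hb, ?_, ?_, ?_⟩
  · intro k A hA
    rw [← hP1 k]
    exact Measure.map_mono (Measure.restrict_mono hA le_rfl) (by fun_prop)
  · intro k
    have h := (hcl k).2.2.1
    rw [hb, hpi, ← measure_inter_add_sdiff _ (measurableSet_alive (X := Rd d) (k+1))] at h
    exact (ENNReal.add_le_add_iff_left (measure_ne_top _ _)).1 h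
  · intro k
    have h := (hcl k).2.2.2.1
    rw [hb, hpi, ← measure_inter_add_sdiff _ (measurableSet_alive (X := Rd d) k), inter_comm] at h
    exact (ENNReal.add_le_add_iff_left (measure_ne_top _ _)).1 h
  · intro k A hA
    refine le_trans ?_ (hcl k).2.2.2.2
    rw [← hP2 k, NN_map _ (by fun_prop) (by fun_prop)]
    exact NN_mono hp (Measure.restrict_mono hA le_rfl) (Eventually.of_forall fun _ => le_rfl)

theorem close_trans {d : ℕ} {p : ℝ} (hp : 1 ≤ p) {μ₁ μ₂ μ₃ : Measure (Rd d)}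
    (f1 : IsFiniteMeasure μ₁) (f2 : IsFiniteMeasure μ₂) (f3 : IsFiniteMeasure μ₃)
    {ε₁ ε₂ : ℝ≥0∞} (h12 : ∃ π, Close p ε₁ μ₁ μ₂ π) (h23 : ∃ π, Close p ε₂ μ₂ μ₃ π) :
    ∃ π, Close p (ε₁ + ε₂) μ₁ μ₃ π := by
  obtain ⟨π₁, h1⟩ := h12
  obtain ⟨π₂, h2⟩ := h23
  let μ : ℕ → Measure (Rd d) := fun k => if k = 0 then μ₁ else if k = 1 then μ₂ else
    if k = 2 then μ₃ else 0
  let π : ℕ → Measure (Rd d × Rd d) := fun k => if k = 0 then π₁ else if k = 1 then π₂ else 0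
  let ε : ℕ → ℝ≥0∞ := fun k => if k = 0 then ε₁ else if k = 1 then ε₂ else μ₃ univ
  have hp0 : 0 < p := by linarith
  have hfin : ∀ k, IsFiniteMeasure (μ k) := by
    intro k
    dsimp only [μ]
    split_ifs <;> infer_instance
  have hcl : ∀ k, Close p (ε k) (μ k) (μ (k+1)) (π k) := by
    intro k
    match k with
    | 0 => simpa [μ, π, ε] using h1
    | 1 => simpa [μ, π, ε] using h2
    | 2 => simp [μ, π, ε, Close, NN, hp0, Measure.zero_le]
    | k + 3 => simp [μ, π, ε, Close, NN, hp0]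
  have hM : ∀ k, μ k univ ≤ μ₁ univ + μ₂ univ + μ₃ univ := by
    intro k
    dsimp only [μ]
    split_ifs
    · rw [add_assoc]; exact le_self_add
    · rw [add_comm (μ₁ univ), add_assoc]; exact le_self_add
    · exact le_add_self
    · simp
  obtain ⟨P, hP, ha, hb, hc, hc', hd⟩ := exists_path_close hp μ hfin π ε hcl _ (by finiteness) hM
  let A : Set (ℕ → Rd d × Bool) := alive 0 ∩ alive 1 ∩ alive 2
  have hA : MeasurableSet A := ((measurableSet_alive 0).inter (measurableSet_alive 1)).inter
    (measurableSet_alive 2)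
  have hg : Measurable (fun ω : ℕ → Rd d × Bool => ((ω 0).1, (ω 2).1)) := by fun_prop
  have hu : ((P.restrict A).map (fun ω => ((ω 0).1, (ω 2).1))) univ = P A := by
    rw [Measure.map_apply hg MeasurableSet.univ]; simp
  refine ⟨(P.restrict A).map (fun ω => ((ω 0).1, (ω 2).1)), ?_, ?_, ?_, ?_, ?_⟩
  · rw [Measure.map_map (by fun_prop) hg]
    exact ha 0 A (fun x hx => hx.1.1)
  · rw [Measure.map_map (by fun_prop) hg]
    exact ha 2 A (fun x hx => hx.2)
  · rw [hu]
    have e : μ₁ univ = P (alive 0) := hb 0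
    rw [e]
    have : (alive 0 : Set (ℕ → Rd d × Bool)) ⊆ A ∪ (alive 0 \ alive 1 ∪ alive 1 \ alive 2) := by
      intro x hx
      simp only [A, mem_union, mem_inter_iff, Set.mem_sdiff]
      tauto
    refine (measure_mono this).trans ((measure_union_le _ _).trans (add_le_add le_rfl ?_))
    exact (measure_union_le _ _).trans (add_le_add (hc 0) (hc 1))
  · rw [hu]
    have e : μ₃ univ = P (alive 2) := hb 2
    rw [e]
    have : (alive 2 : Set (ℕ → Rd d × Bool)) ⊆ A ∪ (alive 1 \ alive 0 ∪ alive 2 \ alive 1) := by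
      intro x hx
      simp only [A, mem_union, mem_inter_iff, Set.mem_sdiff]
      tauto
    refine (measure_mono this).trans ((measure_union_le _ _).trans (add_le_add le_rfl ?_))
    exact (measure_union_le _ _).trans (add_le_add (hc' 0) (hc' 1))
  · rw [NN_map _ hg (by fun_prop)]
    refine (NN_mono hp le_rfl (Eventually.of_forall fun ω : ℕ → Rd d × Bool =>
      edist_triangle (ω 0).1 (ω 1).1 (ω 2).1)).trans ?_
    refine (NN_add hp _ (by fun_prop) (by fun_prop)).trans (add_le_add ?_ ?_)
    · exact hd 0 A (fun x hx => hx.1)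
    · exact hd 1 A (fun x hx => ⟨hx.1.2, hx.2⟩)

theorem close_limit {d : ℕ} {p : ℝ} (hp : 1 ≤ p)
    (μ : ℕ → Measure (Rd d)) (hfin : ∀ k, IsFiniteMeasure (μ k)) (π : ℕ → Measure (Rd d × Rd d))
    (ε : ℕ → ℝ≥0∞) (hε : ∑' k, ε k ≠ ⊤) (hcl : ∀ k, Close p (ε k) (μ k) (μ (k+1)) (π k)) :
    ∃ ν : Measure (Rd d), IsFiniteMeasure ν ∧ ∀ δ : ℝ≥0∞, 0 < δ →
      ∀ᶠ n in atTop, ∃ π', Close p δ (μ n) ν π' := by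
  have hM0 : ∀ k, μ k univ ≤ μ 0 univ + ∑ i ∈ Finset.range k, ε i := by
    intro k
    induction k with
    | zero => simp
    | succ k ih =>
      have h1 : π k univ ≤ μ k univ := by
        have := (hcl k).1 univ
        rwa [Measure.map_apply measurable_fst MeasurableSet.univ] at this
      calc μ (k+1) univ ≤ π k univ + ε k := (hcl k).2.2.2.1
        _ ≤ μ 0 univ + ∑ i ∈ Finset.range k, ε i + ε k := by gcongr; exact h1.trans ih
        _ = _ := by rw [Finset.sum_range_succ, add_assoc]
  have hM : ∀ k, μ k univ ≤ μ 0 univ + ∑' i, ε i := fun k =>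
    (hM0 k).trans (by gcongr; exact ENNReal.sum_le_tsum _)
  obtain ⟨P, hP, ha, hb, hc, -, hd⟩ := exists_path_close hp μ hfin π ε hcl _ (by finiteness) hM
  let A : ℕ → Set (ℕ → Rd d × Bool) := fun n => ⋂ k, alive (n + k)
  have hA : ∀ n, MeasurableSet (A n) := fun n => MeasurableSet.iInter fun k => measurableSet_alive _
  have hAmem : ∀ n k, n ≤ k → A n ⊆ alive k := fun n k hk x hx => by
    have := mem_iInter.1 hx (k - n)
    rwa [Nat.add_sub_cancel' hk] at this
  have hAmono : Monotone A := fun m n hmn x hx =>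
    mem_iInter.2 fun k => hAmem m (n + k) (by omega) hx
  let D : ℕ → (ℕ → Rd d × Bool) → ℝ≥0∞ := fun k ω => edist (ω k).1 (ω (k+1)).1
  have hD : ∀ k, Measurable (D k) := fun k => by fun_prop
  have hN : ∀ n, NN p (P.restrict (A n)) (fun ω => ∑' k, D (n + k) ω) ≤ ∑' k, ε (n + k) := by
    intro n
    refine (NN_tsum hp _ (fun k => hD (n + k))).trans (ENNReal.tsum_le_tsum fun k => ?_)
    exact hd (n + k) (A n) (subset_inter (hAmem _ _ (by omega)) (hAmem _ _ (by omega)))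
  have htail : Tendsto (fun n => ∑' k, ε (n + k)) atTop (𝓝 0) := by
    have := ENNReal.tendsto_sum_nat_add ε hε
    simpa only [add_comm] using this
  have hshift : ∀ n, ∑' k, ε (n + k) ≠ ⊤ := fun n => by
    refine ne_top_of_le_ne_top hε ?_
    exact ENNReal.tsum_comp_le_tsum_of_injective (add_right_injective n) ε
  have hconv : ∀ n, ∀ᵐ ω ∂(P.restrict (A n)), ∃ l, Tendsto (fun k => (ω k).1) atTop (𝓝 l) := by
    intro n
    have hlt : ∫⁻ ω, ∑' k, D (n + k) ω ∂(P.restrict (A n)) ≠ ⊤ :=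
      ne_top_of_le_ne_top (hshift n)
        ((lintegral_le_NN hp _ (Measurable.tsum fun k => hD _)).trans (hN n))
    filter_upwards [ae_lt_top (Measurable.tsum fun k => hD _) hlt] with ω hω
    have hcs : CauchySeq (fun k => (ω (n + k)).1) :=
      cauchySeq_of_edist_le_of_tsum_ne_top (fun k => D (n + k) ω) (fun k => le_rfl) hω.ne
    obtain ⟨l, hl⟩ := cauchySeq_tendsto_of_complete hcs
    refine ⟨l, (tendsto_add_atTop_iff_nat n).1 ?_⟩
    simpa only [add_comm] using hl
  have hconvU : ∀ᵐ ω ∂(P.restrict (⋃ n, A n)), ∃ l, Tendsto (fun k => (ω k).1) atTop (𝓝 l) :=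
    (ae_restrict_iUnion_iff _ _).2 hconv
  obtain ⟨L, hLm, hL⟩ := measurable_limit_of_tendsto_metrizable_ae
    (fun k => (show Measurable (fun ω : ℕ → Rd d × Bool => (ω k).1) by fun_prop).aemeasurable)
    hconvU
  have hLn := (ae_restrict_iUnion_iff _ _).1 hL
  refine ⟨(P.restrict (⋃ n, A n)).map L, inferInstance, fun δ hδ => ?_⟩
  have hPA : Tendsto (fun n => P (A n) + δ) atTop (𝓝 (P (⋃ n, A n) + δ)) :=
    (tendsto_measure_iUnion_atTop hAmono).add tendsto_const_nhds
  have hev1 : ∀ᶠ n in atTop, P (⋃ n, A n) < P (A n) + δ :=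
    hPA.eventually_const_lt (ENNReal.lt_add_right (measure_ne_top _ _) hδ.ne')
  have hev2 : ∀ᶠ n in atTop, ∑' k, ε (n + k) < δ := htail.eventually_lt_const hδ
  filter_upwards [hev1, hev2] with n h1 h2
  have hg : Measurable (fun ω : ℕ → Rd d × Bool => ((ω n).1, L ω)) := by fun_prop
  have hu : ((P.restrict (A n)).map (fun ω => ((ω n).1, L ω))) univ = P (A n) := by
    rw [Measure.map_apply hg MeasurableSet.univ]; simp
  refine ⟨(P.restrict (A n)).map (fun ω => ((ω n).1, L ω)), ?_, ?_, ?_, ?_, ?_⟩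
  · rw [Measure.map_map (by fun_prop) hg]
    exact ha n (A n) (hAmem n n le_rfl)
  · rw [Measure.map_map (by fun_prop) hg]
    exact Measure.map_mono (Measure.restrict_mono (subset_iUnion A n) le_rfl) hLm
  · rw [hu, hb n]
    have hsub : (alive n : Set (ℕ → Rd d × Bool)) ⊆
        A n ∪ ⋃ k, (alive (n + k) \ alive (n + k + 1)) := by
      intro x hx
      by_contra hcon
      simp only [mem_union, mem_iUnion, Set.mem_sdiff, not_or, not_exists, not_and, not_not] at hcon
      refine hcon.1 (mem_iInter.2 fun k => ?_)
      induction k with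
      | zero => exact hx
      | succ k ih => exact hcon.2 k ih
    refine (measure_mono hsub).trans ((measure_union_le _ _).trans (add_le_add le_rfl ?_))
    exact (measure_iUnion_le _).trans ((ENNReal.tsum_le_tsum fun k => hc (n + k)).trans h2.le)
  · rw [hu, Measure.map_apply hLm MeasurableSet.univ]
    simpa using h1.le
  · rw [NN_map _ hg (by fun_prop)]
    refine (NN_mono hp le_rfl ?_).trans ((hN n).trans h2.le)
    filter_upwards [hLn n] with ω hω
    exact edist_le_tsum_of_edist_le_of_tendsto (fun k => D k ω) (fun k => le_rfl) hω n

theorem le_sub_add {X : Type} [MeasurableSpace X] (μ ν : Measure X) [IsFiniteMeasure μ]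
    [IsFiniteMeasure ν] : μ ≤ (μ - ν) + ν :=
  Measure.sub_le_iff_le_add.1 le_rfl

theorem univ_le_tv {d : ℕ} (μ ν : Measure (Rd d)) [IsFiniteMeasure μ]
    [IsFiniteMeasure ν] : μ univ ≤ ν univ + tv μ ν := by
  have h := le_sub_add μ ν univ
  rw [Measure.add_apply] at h
  unfold tv
  calc μ univ ≤ (μ - ν) univ + ν univ := h
    _ ≤ ν univ + ((μ - ν) univ + (ν - μ) univ) := by
      rw [add_comm]; gcongr; exact le_self_add

/-- The part of a plan whose image lies below `μ`. -/
theorem exists_restrict {Ω X : Type} [MeasurableSpace Ω] [MeasurableSpace X] (σ : Measure Ω)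
    [IsFiniteMeasure σ] (h : Ω → X) (hh : Measurable h) (μ : Measure X) [IsFiniteMeasure μ] :
    ∃ σ' : Measure Ω, σ' ≤ σ ∧ σ'.map h ≤ μ ∧ σ univ ≤ σ' univ + (σ.map h - μ) univ := by
  obtain ⟨σ', h1, h2⟩ := exists_le_map σ h hh (σ.map h - (σ.map h - μ)) Measure.sub_le
  refine ⟨σ', h1, ?_, ?_⟩
  · rw [h2]
    refine Measure.sub_le_of_le_add ?_
    rw [add_comm]
    exact le_sub_add _ _
  · have e1 : σ univ = σ.map h univ := by rw [Measure.map_apply hh MeasurableSet.univ]; rfl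
    have e2 : σ' univ = σ'.map h univ := by rw [Measure.map_apply hh MeasurableSet.univ]; rfl
    rw [e1, e2, h2, ← Measure.add_apply]
    exact le_sub_add _ _ univ

theorem NN_smul {Ω : Type} [MeasurableSpace Ω] {p : ℝ} (hp : 1 ≤ p) (q : Measure Ω)
    [IsProbabilityMeasure q] (m : ℝ≥0∞) (hm0 : m ≠ 0) (hmt : m ≠ ⊤) (f : Ω → ℝ≥0∞) :
    NN p (m • q) f = m * (∫⁻ x, f x ^ p ∂q) ^ (1/p) := by
  have hp0 : 0 < p := by linarith
  unfold NN
  rw [Measure.smul_apply, lintegral_smul_measure, smul_eq_mul, smul_eq_mul, measure_univ, mul_one,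
    ENNReal.mul_rpow_of_nonneg _ _ (by positivity), ← mul_assoc, ← ENNReal.rpow_add _ _ hm0 hmt]
  simp

theorem exists_plan_of_Wp_lt {d : ℕ} {p : ℝ} (hp : 1 ≤ p) {μ ν : Measure (Rd d)}
    [IsFiniteMeasure μ] [IsFiniteMeasure ν] (huniv : μ univ = ν univ) {ε : ℝ≥0∞}
    (h : Wp p μ ν < ε) :
    ∃ π : Measure (Rd d × Rd d), π.map Prod.fst = μ ∧ π.map Prod.snd = ν ∧
      NN p π (fun q => edist q.1 q.2) ≤ ε := by
  have hp0 : 0 < p := by linarith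
  by_cases hm : μ univ = 0
  · have hn : ν univ = 0 := huniv ▸ hm
    rw [Measure.measure_univ_eq_zero] at hm hn
    refine ⟨0, by simp [hm], by simp [hn], by simp [NN, hp0]⟩
  have hmt : μ univ ≠ ⊤ := measure_ne_top _ _
  have : ∃ q : {π : Measure (Rd d × Rd d) // IsPlan μ ν π},
      μ univ * planCost p q.1 ^ (1/p) < ε := by
    by_contra! hcon
    refine absurd h (not_lt.2 ?_)
    unfold Wp
    rw [mul_comm, ← ENNReal.div_le_iff hm hmt, one_div, ENNReal.le_rpow_inv_iff hp0]
    refine le_iInf fun q => ?_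
    rw [← ENNReal.le_rpow_inv_iff hp0, ← one_div, ENNReal.div_le_iff hm hmt, mul_comm]
    exact hcon q
  obtain ⟨⟨q, hq, hq1, hq2⟩, hlt⟩ := this
  refine ⟨μ univ • q, ?_, ?_, ?_⟩
  · rw [Measure.map_smul, hq1, smul_smul, ENNReal.mul_inv_cancel hm hmt, one_smul]
  · rw [Measure.map_smul, hq2, huniv, smul_smul,
      ENNReal.mul_inv_cancel (huniv ▸ hm) (huniv ▸ hmt), one_smul]
  · rw [NN_smul hp q _ hm hmt]
    exact hlt.le

theorem close_of_Wab {d : ℕ} {a b p : ℝ} (ha : 0 < a) (hb : 0 < b) (hp : 1 ≤ p) {ε : ℝ≥0∞}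
    (hε : 0 < ε) : ∃ δ : ℝ≥0∞, 0 < δ ∧ ∀ μ ν : Measure (Rd d), IsFiniteMeasure μ →
      IsFiniteMeasure ν → Wab a b p μ ν < δ → ∃ π, Close p ε μ ν π := by
  have hp0 : 0 < p := by linarith
  have hA0 : ENNReal.ofReal a ≠ 0 := by simpa using ha
  have hB0 : ENNReal.ofReal b ≠ 0 := by simpa using hb
  have hAt : ENNReal.ofReal a ≠ ⊤ := ENNReal.ofReal_ne_top
  have hBt : ENNReal.ofReal b ≠ ⊤ := ENNReal.ofReal_ne_top
  refine ⟨min (ENNReal.ofReal a * (ε / 2)) (ENNReal.ofReal b * ε), ?_, ?_⟩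
  · refine lt_min (ENNReal.mul_pos hA0 (by simp [hε.ne'])) (ENNReal.mul_pos hB0 hε.ne')
  intro μ ν hμ hν h
  set δ := min (ENNReal.ofReal a * (ε / 2)) (ENNReal.ofReal b * ε)
  have hT : Tab a b p μ ν < δ ^ p := by
    have := ENNReal.rpow_lt_rpow h hp0
    unfold Wab at this
    rwa [← ENNReal.rpow_mul, one_div_mul_cancel hp0.ne', ENNReal.rpow_one] at this
  unfold Tab at hT
  simp only [iInf_lt_iff] at hT
  obtain ⟨μ', ν', hμ', hν', huniv, hlt⟩ := hT
  rw [← ENNReal.mul_rpow_of_nonneg _ _ hp0.le, ← ENNReal.mul_rpow_of_nonneg _ _ hp0.le] at hlt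
  have h1 : ENNReal.ofReal a * (tv μ μ' + tv ν ν') < ENNReal.ofReal a * (ε / 2) :=
    ((ENNReal.rpow_lt_rpow_iff hp0).1 (le_self_add.trans_lt hlt)).trans_le (min_le_left _ _)
  have h2 : ENNReal.ofReal b * Wp p μ' ν' < ENNReal.ofReal b * ε :=
    ((ENNReal.rpow_lt_rpow_iff hp0).1 (le_add_self.trans_lt hlt)).trans_le (min_le_right _ _)
  have h1' : tv μ μ' + tv ν ν' ≤ ε / 2 := ((ENNReal.mul_lt_mul_iff_right hA0 hAt).1 h1).le
  have h2' : Wp p μ' ν' < ε := (ENNReal.mul_lt_mul_iff_right hB0 hBt).1 h2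
  obtain ⟨π₀, hf, hs, hN⟩ := exists_plan_of_Wp_lt hp huniv h2'
  have hu0 : π₀ univ = μ' univ := by
    rw [← hf, Measure.map_apply measurable_fst MeasurableSet.univ]; rfl
  have : IsFiniteMeasure π₀ := ⟨by rw [hu0]; exact measure_lt_top _ _⟩
  obtain ⟨π₁, hle1, hm1, hl1⟩ := exists_restrict π₀ Prod.fst measurable_fst μ
  have : IsFiniteMeasure π₁ := isFiniteMeasure_of_le _ hle1
  obtain ⟨π₂, hle2, hm2, hl2⟩ := exists_restrict π₁ Prod.snd measurable_snd ν
  have hs1 : (π₁.map Prod.snd - ν) univ ≤ (ν' - ν) univ := by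
    refine (Measure.sub_le_of_le_add ?_ : π₁.map Prod.snd - ν ≤ ν' - ν) univ
    refine (Measure.map_mono hle1 measurable_snd).trans ?_
    rw [hs]
    exact le_sub_add _ _
  have hmass : μ' univ ≤ π₂ univ + ε / 2 := by
    rw [← hu0]
    rw [hf] at hl1
    calc π₀ univ ≤ π₂ univ + (ν' - ν) univ + (μ' - μ) univ :=
          hl1.trans (by gcongr; exact hl2.trans (by gcongr))
      _ ≤ π₂ univ + (tv μ μ' + tv ν ν') := by
        rw [add_assoc, add_comm (tv μ μ')]
        unfold tv
        gcongr <;> exact le_add_self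
      _ ≤ _ := by gcongr
  refine ⟨π₂, (Measure.map_mono hle2 measurable_fst).trans hm1, hm2, ?_, ?_, ?_⟩
  · calc μ univ ≤ μ' univ + tv μ μ' := univ_le_tv _ _
      _ ≤ (π₂ univ + ε / 2) + ε / 2 := add_le_add hmass (le_self_add.trans h1')
      _ = _ := by rw [add_assoc, ENNReal.add_halves]
  · calc ν univ ≤ ν' univ + tv ν ν' := univ_le_tv _ _
      _ ≤ (π₂ univ + ε / 2) + ε / 2 := add_le_add (huniv ▸ hmass) (le_add_self.trans h1')
      _ = _ := by rw [add_assoc, ENNReal.add_halves]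
  · exact (NN_mono hp (hle2.trans hle1) (Eventually.of_forall fun _ => le_rfl)).trans hN

theorem tv_le_of_le {d : ℕ} {μ μ' : Measure (Rd d)} [IsFiniteMeasure μ] (h : μ' ≤ μ) {ε : ℝ≥0∞}
    (hε : μ univ ≤ μ' univ + ε) : tv μ μ' ≤ ε := by
  have : IsFiniteMeasure μ' := isFiniteMeasure_of_le _ h
  unfold tv
  rw [Measure.sub_eq_zero_of_le h, Measure.sub_apply MeasurableSet.univ h]
  simpa [add_comm] using hε

theorem Wp_le {d : ℕ} {p : ℝ} (hp : 1 ≤ p) (π : Measure (Rd d × Rd d)) [IsFiniteMeasure π] :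
    Wp p (π.map Prod.fst) (π.map Prod.snd) ≤ NN p π (fun q => edist q.1 q.2) := by
  have e1 : π.map Prod.fst univ = π univ := by
    rw [Measure.map_apply measurable_fst MeasurableSet.univ]; rfl
  have e2 : π.map Prod.snd univ = π univ := by
    rw [Measure.map_apply measurable_snd MeasurableSet.univ]; rfl
  have hp0 : 0 < p := by linarith
  unfold Wp
  rw [e1]
  by_cases hm : π univ = 0
  · simp [hm]
  have hmt : π univ ≠ ⊤ := measure_ne_top _ _
  have hprob : IsProbabilityMeasure ((π univ)⁻¹ • π) :=
    ⟨by simp [ENNReal.inv_mul_cancel hm hmt]⟩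
  have hplan : IsPlan (π.map Prod.fst) (π.map Prod.snd) ((π univ)⁻¹ • π) :=
    ⟨hprob, by rw [Measure.map_smul, e1], by rw [Measure.map_smul, e2]⟩
  have e3 : π = π univ • ((π univ)⁻¹ • π) := by
    rw [smul_smul, ENNReal.mul_inv_cancel hm hmt, one_smul]
  have e4 : NN p π (fun q => edist q.1 q.2) =
      π univ * (planCost p ((π univ)⁻¹ • π)) ^ (1/p) := by
    conv_lhs => rw [e3]
    exact NN_smul hp _ _ hm hmt _
  rw [e4]
  gcongr
  exact iInf_le (fun q : {q // IsPlan (π.map Prod.fst) (π.map Prod.snd) q} => planCost p q.1)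
    ⟨_, hplan⟩

theorem Wab_le_of_close {d : ℕ} {a b p : ℝ} (hp : 1 ≤ p) {ε : ℝ≥0∞}
    {μ ν : Measure (Rd d)} (hμ : IsFiniteMeasure μ) (hν : IsFiniteMeasure ν)
    (h : ∃ π, Close p ε μ ν π) :
    Wab a b p μ ν ≤ (ENNReal.ofReal a * 2 + ENNReal.ofReal b) * ε := by
  have hp0 : 0 < p := by linarith
  obtain ⟨π, h1, h2, h3, h4, h5⟩ := h
  have e1 : π.map Prod.fst univ = π univ := by
    rw [Measure.map_apply measurable_fst MeasurableSet.univ]; rfl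
  have e2 : π.map Prod.snd univ = π univ := by
    rw [Measure.map_apply measurable_snd MeasurableSet.univ]; rfl
  have f1 : IsFiniteMeasure (π.map Prod.fst) := isFiniteMeasure_of_le _ h1
  have f2 : IsFiniteMeasure (π.map Prod.snd) := isFiniteMeasure_of_le _ h2
  have : IsFiniteMeasure π := ⟨by rw [← e1]; exact measure_lt_top _ _⟩
  have hT : Tab a b p μ ν ≤ (ENNReal.ofReal a * (ε + ε)) ^ p + (ENNReal.ofReal b * ε) ^ p := by
    unfold Tab
    refine (iInf_le_of_le (π.map Prod.fst) <| iInf_le_of_le (π.map Prod.snd) <|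
      iInf_le_of_le f1 <| iInf_le_of_le f2 <| iInf_le_of_le (e1.trans e2.symm) le_rfl).trans ?_
    rw [← ENNReal.mul_rpow_of_nonneg _ _ hp0.le, ← ENNReal.mul_rpow_of_nonneg _ _ hp0.le]
    gcongr
    · exact tv_le_of_le h1 (by rwa [e1])
    · exact tv_le_of_le h2 (by rwa [e2])
    · exact (Wp_le hp π).trans h5
  unfold Wab
  calc Tab a b p μ ν ^ (1/p) ≤ _ := ENNReal.rpow_le_rpow hT (by positivity)
    _ ≤ ENNReal.ofReal a * (ε + ε) + ENNReal.ofReal b * ε := ENNReal.rpow_add_rpow_le_add _ _ hp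
    _ = _ := by ring

end WabAux

/-- the space of positive finite Borel measures endowed with `W_p^{a,b}`
is complete: every Cauchy sequence converges. -/
theorem Wab_complete {d : ℕ} (a b p : ℝ) (ha : 0 < a) (hb : 0 < b) (hp : 1 ≤ p)
    (μ : ℕ → Measure (Rd d)) (hfin : ∀ n, IsFiniteMeasure (μ n))
    (hcauchy : ∀ ε : ℝ≥0∞, 0 < ε → ∃ N : ℕ, ∀ m n : ℕ, N ≤ m → N ≤ n →
      Wab a b p (μ m) (μ n) < ε) :
    ∃ ν : Measure (Rd d), IsFiniteMeasure ν ∧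
      Filter.Tendsto (fun n => Wab a b p (μ n) ν) Filter.atTop (nhds 0) := by
  have hC : ∀ ε : ℝ≥0∞, 0 < ε → ∃ N : ℕ, ∀ m n : ℕ, N ≤ m → N ≤ n →
      ∃ π, WabAux.Close p ε (μ m) (μ n) π := by
    intro ε hε
    obtain ⟨δ, hδ, h⟩ := WabAux.close_of_Wab (d := d) ha hb hp hε
    obtain ⟨N, hN⟩ := hcauchy δ hδ
    exact ⟨N, fun m n hm hn => h _ _ (hfin m) (hfin n) (hN m n hm hn)⟩
  have hpos : ∀ k : ℕ, (0 : ℝ≥0∞) < (2⁻¹ : ℝ≥0∞) ^ k := fun k =>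
    ENNReal.pow_pos (by simp) k
  choose N hN using fun k : ℕ => hC ((2⁻¹ : ℝ≥0∞) ^ k) (hpos k)
  let φ : ℕ → ℕ := fun k => (∑ i ∈ Finset.range (k + 1), N i) + k
  have hφN : ∀ k, N k ≤ φ k := fun k => by
    have : N k ≤ ∑ i ∈ Finset.range (k + 1), N i :=
      Finset.single_le_sum (f := N) (fun _ _ => Nat.zero_le _) (by simp)
    exact this.trans (Nat.le_add_right _ _)
  have hφs : ∀ k, φ k ≤ φ (k + 1) := fun k => by
    simp only [φ]
    rw [Finset.sum_range_succ _ (k + 1)]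
    omega
  choose π hπ using fun k => hN k (φ k) (φ (k+1)) (hφN k) ((hφN k).trans (hφs k))
  have hsum : ∑' k : ℕ, (2⁻¹ : ℝ≥0∞) ^ k ≠ ⊤ := by
    rw [ENNReal.tsum_geometric]; simp
  obtain ⟨ν, hν, hlim⟩ := WabAux.close_limit hp (fun k => μ (φ k)) (fun k => hfin _) π _ hsum hπ
  refine ⟨ν, hν, ?_⟩
  have hK : ENNReal.ofReal a * 2 + ENNReal.ofReal b ≠ ⊤ := by finiteness
  have hK0 : ENNReal.ofReal a * 2 + ENNReal.ofReal b ≠ 0 := by simp [hb]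
  rw [ENNReal.tendsto_atTop_zero]
  intro ε hε
  set K := ENNReal.ofReal a * 2 + ENNReal.ofReal b
  have hη : 0 < ε / K / 2 := by simp [ENNReal.div_pos_iff, hε.ne', hK]
  obtain ⟨N₀, hN₀⟩ := hC _ hη
  obtain ⟨n, hn, hn2⟩ := ((hlim _ hη).and (Filter.eventually_ge_atTop N₀)).exists
  refine ⟨N₀, fun m hm => ?_⟩
  have hφn : N₀ ≤ φ n := hn2.trans (Nat.le_add_left _ _)
  have hcl := WabAux.close_trans hp (hfin m) (hfin (φ n)) hν (hN₀ m (φ n) hm hφn) hn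
  refine (WabAux.Wab_le_of_close (a := a) (b := b) hp (hfin m) hν hcl).trans ?_
  rw [ENNReal.add_halves, mul_comm]
  exact (ENNReal.div_mul_cancel hK0 hK).le
end
end

section
/- For positive finite Borel measures μ, ν on ℝ^d with finite first moments, the generalized Wasserstein distance W_1^{1,1}(μ,ν) equals the flat metric (bounded Lipschitz distance) d(μ,ν) = sup { ∫ f d(μ−ν) : f ∈ C^0_c(ℝ^d,ℝ), ‖f‖_∞ ≤ 1 and Lip(f) ≤ 1 }. -/
open MeasureTheory Set
open scoped ENNReal NNReal

noncomputable section

theorem finite_duality {ι : Type} [Fintype ι] [DecidableEq ι] (c : ι → ι → ℝ)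
    (hc : ∀ i j, 0 ≤ c i j) (a b : ι → ℝ) :
    ∃ (γ : ι → ι → ℝ) (u v : ι → ℝ), (∀ i j, 0 ≤ γ i j) ∧ (∀ i, |u i| ≤ 1) ∧ (∀ i, |v i| ≤ 1) ∧
      (∀ i j, u i + v j ≤ c i j) ∧
      ∑ i, ∑ j, c i j * γ i j + ∑ i, |a i - ∑ j, γ i j| + ∑ j, |b j - ∑ i, γ i j| ≤
        ∑ i, u i * a i + ∑ j, v j * b j := by
  set M : ℝ := 2 * ∑ i, |a i| + ∑ j, |b j| + 1 with hM
  have hM0 : 0 ≤ M := by positivity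
  set X : Set (ι → ι → ℝ) := Icc 0 (fun _ _ => M) with hX
  set Y : Set ((ι → ℝ) × (ι → ℝ)) := Icc (fun _ => -1, fun _ => -1) (fun _ => 1, fun _ => 1) with hY
  let L : (ι → ι → ℝ) → ((ι → ℝ) × (ι → ℝ)) → ℝ := fun γ w =>
    ∑ i, ∑ j, (c i j - w.1 i - w.2 j) * γ i j + ∑ i, w.1 i * a i + ∑ j, w.2 j * b j
  have key : ∃ γ ∈ X, ∃ w ∈ Y, IsSaddlePointOn X Y L γ w := by
    apply Sion.exists_isSaddlePointOn
    · exact ⟨0, by simp [hX, Pi.le_def, hM0]⟩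
    · exact convex_Icc _ _
    · exact isCompact_Icc
    · intro y _
      refine Continuous.lowerSemicontinuous ?_ |>.lowerSemicontinuousOn _
      simp only [L]; fun_prop
    · intro y _
      apply ConvexOn.quasiconvexOn
      refine ⟨convex_Icc _ _, fun p _ q _ s t _ _ hst => le_of_eq ?_⟩
      have e : ∑ i, ∑ j, (c i j - y.1 i - y.2 j) * (s • p + t • q) i j =
          s * ∑ i, ∑ j, (c i j - y.1 i - y.2 j) * p i j
          + t * ∑ i, ∑ j, (c i j - y.1 i - y.2 j) * q i j := by
        simp only [Finset.mul_sum, ← Finset.sum_add_distrib, Pi.add_apply, Pi.smul_apply,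
          smul_eq_mul]
        refine Finset.sum_congr rfl fun i _ => Finset.sum_congr rfl fun j _ => ?_
        ring
      simp only [L, e, smul_eq_mul]
      linear_combination -(∑ i, y.1 i * a i + ∑ j, y.2 j * b j) * hst
    · exact convex_Icc _ _
    · exact ⟨0, by simp [hY, Prod.le_def, Pi.le_def]⟩
    · exact isCompact_Icc
    · intro y _
      refine Continuous.upperSemicontinuous ?_ |>.upperSemicontinuousOn _
      simp only [L]; fun_prop
    · intro y _
      apply ConcaveOn.quasiconcaveOn
      refine ⟨convex_Icc _ _, fun p _ q _ s t _ _ hst => le_of_eq ?_⟩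
      have e : ∑ i, ∑ j, (c i j - (s • p + t • q).1 i - (s • p + t • q).2 j) * y i j =
          s * ∑ i, ∑ j, (c i j - p.1 i - p.2 j) * y i j
          + t * ∑ i, ∑ j, (c i j - q.1 i - q.2 j) * y i j := by
        simp only [Finset.mul_sum, ← Finset.sum_add_distrib, Prod.fst_add, Prod.snd_add,
          Prod.smul_fst, Prod.smul_snd, Pi.add_apply, Pi.smul_apply, smul_eq_mul]
        refine Finset.sum_congr rfl fun i _ => Finset.sum_congr rfl fun j _ => ?_
        linear_combination -(c i j * y i j) * hst
      have e1 : ∑ i, (s • p + t • q).1 i * a i = s * ∑ i, p.1 i * a i + t * ∑ i, q.1 i * a i := by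
        simp only [Finset.mul_sum, ← Finset.sum_add_distrib, Prod.fst_add,
          Prod.smul_fst, Pi.add_apply, Pi.smul_apply, smul_eq_mul]
        refine Finset.sum_congr rfl fun i _ => ?_
        ring
      have e2 : ∑ i, (s • p + t • q).2 i * b i = s * ∑ i, p.2 i * b i + t * ∑ i, q.2 i * b i := by
        simp only [Finset.mul_sum, ← Finset.sum_add_distrib, Prod.snd_add,
          Prod.smul_snd, Pi.add_apply, Pi.smul_apply, smul_eq_mul]
        refine Finset.sum_congr rfl fun i _ => ?_
        ring
      simp only [L, e, e1, e2, smul_eq_mul]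
      ring
  obtain ⟨γ, hγ, ⟨u, v⟩, hw, hs⟩ := key
  have hγ0 : ∀ i j, 0 ≤ γ i j := fun i j => hγ.1 i j
  have hu : ∀ i, |u i| ≤ 1 := fun i => abs_le.2 ⟨hw.1.1 i, hw.2.1 i⟩
  have hv : ∀ i, |v i| ≤ 1 := fun i => abs_le.2 ⟨hw.1.2 i, hw.2.2 i⟩
  have hL : ∀ (g : ι → ι → ℝ) (u v : ι → ℝ), L g (u, v) = ∑ i, ∑ j, c i j * g i j
      + ∑ i, u i * (a i - ∑ j, g i j) + ∑ j, v j * (b j - ∑ i, g i j) := by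
    intro g u v
    simp only [L, sub_mul, mul_sub, Finset.sum_sub_distrib, Finset.mul_sum]
    rw [Finset.sum_comm (f := fun i j => v j * g i j)]
    ring
  have hF : ∀ g ∈ X, ∑ i, ∑ j, c i j * γ i j + ∑ i, |a i - ∑ j, γ i j|
      + ∑ j, |b j - ∑ i, γ i j| ≤ L g (u, v) := by
    intro g hg
    have := hs g hg (fun i => SignType.sign (a i - ∑ j, γ i j), fun j => SignType.sign (b j - ∑ i, γ i j)) ?_
    · rw [hL] at this
      simpa only [sign_mul_self] using this
    · have h1 : ∀ x : ℝ, -1 ≤ ((SignType.sign x : SignType) : ℝ) ∧ ((SignType.sign x : SignType) : ℝ) ≤ 1 := by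
        intro x
        cases SignType.sign x <;> simp
      exact ⟨⟨fun i => (h1 _).1, fun i => (h1 _).1⟩, ⟨fun i => (h1 _).2, fun i => (h1 _).2⟩⟩
  have h0 := hF 0 ⟨le_rfl, fun _ _ => hM0⟩
  have h00 : L 0 (u, v) = ∑ i, u i * a i + ∑ j, v j * b j := by simp [L]
  rw [h00] at h0
  have hb1 : ∀ (u a : ι → ℝ), (∀ i, |u i| ≤ 1) → ∑ i, u i * a i ≤ ∑ i, |a i| := by
    intro u a hu
    refine Finset.sum_le_sum fun i _ => (le_abs_self _).trans ?_
    rw [abs_mul]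
    exact mul_le_of_le_one_left (abs_nonneg _) (hu i)
  have hlt : ∀ i j, γ i j < M := by
    intro i j
    have e1 : γ i j ≤ ∑ j, γ i j := Finset.single_le_sum (fun j _ => hγ0 i j) (Finset.mem_univ j)
    have e2 : |a i - ∑ j, γ i j| ≤ ∑ i, |a i - ∑ j, γ i j| :=
      Finset.single_le_sum (f := fun i => |a i - ∑ j, γ i j|) (fun j _ => abs_nonneg _) (Finset.mem_univ i)
    have e3 : |a i| ≤ ∑ i, |a i| :=
      Finset.single_le_sum (f := fun i => |a i|) (fun j _ => abs_nonneg _) (Finset.mem_univ i)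
    have e4 : 0 ≤ ∑ i, ∑ j, c i j * γ i j :=
      Finset.sum_nonneg fun i _ => Finset.sum_nonneg fun j _ => mul_nonneg (hc i j) (hγ0 i j)
    have e5 : 0 ≤ ∑ j, |b j - ∑ i, γ i j| := by positivity
    have e6 := hb1 u a hu
    have e7 := hb1 v b hv
    have e8 := neg_abs_le (a i - ∑ j, γ i j)
    have e9 := le_abs_self (a i)
    linarith
  refine ⟨γ, u, v, hγ0, hu, hv, ?_, h0⟩
  intro i j
  have h1 := hs (fun i' j' => γ i' j' + if i' = i ∧ j' = j then M - γ i j else 0) ?_ (u, v) hw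
  · simp only [L, mul_add, Finset.sum_add_distrib] at h1
    have : ∑ x, ∑ x_1, (c x x_1 - u x - v x_1) * (if x = i ∧ x_1 = j then M - γ i j else 0)
        = (c i j - u i - v j) * (M - γ i j) := by
      rw [Finset.sum_eq_single i, Finset.sum_eq_single j]
      · simp
      · intro k _ hk; simp [hk]
      · simp
      · intro k _ hk; simp [hk]
      · simp
    rw [this] at h1
    have h2 : 0 ≤ (c i j - u i - v j) * (M - γ i j) := by linarith
    have := nonneg_of_mul_nonneg_left h2 (sub_pos.2 (hlt i j))
    linarith
  · constructor
    · intro i' j'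
      have := hγ0 i' j'
      have := hlt i j
      simp only [Pi.zero_apply]
      split_ifs <;> linarith
    · intro i' j'
      have := hlt i' j'
      have := hlt i j
      dsimp only
      split_ifs with h
      · obtain ⟨rfl, rfl⟩ := h; linarith
      · linarith

theorem bl_integrable {d : ℕ} (μ : Measure (Rd d)) [IsFiniteMeasure μ] (f : Rd d → ℝ)
    (hf : Continuous f) (hb : ∀ x, |f x| ≤ 1) : Integrable f μ :=
  Integrable.of_bound hf.aestronglyMeasurable 1 (Filter.Eventually.of_forall hb)

theorem bl_abs_integral_le {d : ℕ} (μ : Measure (Rd d)) [IsFiniteMeasure μ] (f : Rd d → ℝ)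
    (hb : ∀ x, |f x| ≤ 1) : |∫ x, f x ∂μ| ≤ (μ univ).toReal := by
  have := norm_integral_le_of_norm_le_const (μ := μ) (f := f) (C := 1)
    (Filter.Eventually.of_forall hb)
  simpa [Measure.real] using this

theorem measure_add_sub_swap {d : ℕ} (μ ν : Measure (Rd d)) [IsFiniteMeasure μ]
    [IsFiniteMeasure ν] : μ + (ν - μ) = ν + (μ - ν) := by
  have h := Measure.sub_toSignedMeasure_eq_toSignedMeasure_sub (μ := μ) (ν := ν)
  rw [sub_eq_sub_iff_add_eq_add, ← Measure.toSignedMeasure_add, ← Measure.toSignedMeasure_add,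
    Measure.toSignedMeasure_eq_toSignedMeasure_iff] at h
  rw [h, add_comm]

theorem int_sub_le_tv {d : ℕ} (μ ν : Measure (Rd d)) [IsFiniteMeasure μ] [IsFiniteMeasure ν]
    (f : Rd d → ℝ) (hf : Continuous f) (hb : ∀ x, |f x| ≤ 1) :
    |∫ x, f x ∂μ - ∫ x, f x ∂ν| ≤ (tv μ ν).toReal := by
  have h := congrArg (fun m => ∫ x, f x ∂m) (measure_add_sub_swap μ ν)
  rw [integral_add_measure (bl_integrable _ f hf hb) (bl_integrable _ f hf hb),
    integral_add_measure (bl_integrable _ f hf hb) (bl_integrable _ f hf hb)] at h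
  have h1 := bl_abs_integral_le (μ - ν) f hb
  have h2 := bl_abs_integral_le (ν - μ) f hb
  unfold tv
  rw [ENNReal.toReal_add (measure_ne_top _ _) (measure_ne_top _ _)]
  rw [abs_le] at *
  constructor <;> linarith

theorem int_sub_le_Wp {d : ℕ} (μ ν : Measure (Rd d)) [IsFiniteMeasure μ] [IsFiniteMeasure ν]
    (hm : μ univ = ν univ)
    (f : Rd d → ℝ) (hf : LipschitzWith 1 f) (hb : ∀ x, |f x| ≤ 1) :
    ENNReal.ofReal (∫ x, f x ∂μ - ∫ x, f x ∂ν) ≤ Wp 1 μ ν := by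
  by_cases h0 : μ univ = 0
  · have h0' : ν univ = 0 := hm ▸ h0
    rw [Measure.measure_univ_eq_zero] at h0 h0'
    simp [h0, h0']
  have hT : μ univ ≠ ⊤ := measure_ne_top _ _
  unfold Wp
  rw [div_one, ENNReal.rpow_one, ENNReal.mul_iInf_of_ne h0 hT]
  refine le_iInf ?_
  rintro ⟨π, hπ, h1, h2⟩
  unfold planCost
  simp only [ENNReal.rpow_one]
  have key : ∀ (ρ : Measure (Rd d)) (g : Rd d × Rd d → Rd d), Measurable g →
      ρ univ = μ univ → π.map g = (ρ univ)⁻¹ • ρ → ∫ x, f x ∂ρ = (μ univ).toReal * ∫ q, f (g q) ∂π := by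
    intro ρ g hg hρ h
    rw [← integral_map hg.aemeasurable hf.continuous.aestronglyMeasurable, h,
      integral_smul_measure, hρ, ENNReal.toReal_inv, smul_eq_mul, ← mul_assoc,
      mul_inv_cancel₀, one_mul]
    exact ENNReal.toReal_ne_zero.2 ⟨h0, hT⟩
  rw [key μ Prod.fst measurable_fst rfl h1, key ν Prod.snd measurable_snd hm.symm h2, ← mul_sub,
    ENNReal.ofReal_mul ENNReal.toReal_nonneg, ENNReal.ofReal_toReal hT]
  gcongr
  have hi : ∀ g : Rd d × Rd d → Rd d, Continuous g → Integrable (fun q => f (g q)) π := fun g hg =>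
    Integrable.of_bound (hf.continuous.comp hg).aestronglyMeasurable 1
      (Filter.Eventually.of_forall fun q => hb _)
  rw [← integral_sub (hi _ continuous_fst) (hi _ continuous_snd)]
  refine (ENNReal.ofReal_le_ofReal (le_abs_self _)).trans ?_
  rw [← Real.norm_eq_abs, ofReal_norm]
  refine (enorm_integral_le_lintegral_enorm _).trans (lintegral_mono fun q => ?_)
  rw [← edist_eq_enorm_sub]
  simpa using hf q.1 q.2

def flatSet {d : ℕ} (μ ν : Measure (Rd d)) : Set ℝ :=
  {r : ℝ | ∃ f : Rd d → ℝ, Continuous f ∧ HasCompactSupport f ∧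
        (∀ x, |f x| ≤ 1) ∧ LipschitzWith 1 f ∧ r = ∫ x, f x ∂μ - ∫ x, f x ∂ν}

theorem flatSet_le {d : ℕ} (μ ν : Measure (Rd d)) [IsFiniteMeasure μ] [IsFiniteMeasure ν]
    {r : ℝ} (hr : r ∈ flatSet μ ν) : ENNReal.ofReal r ≤ Wab 1 1 1 μ ν := by
  obtain ⟨f, hf, -, hb, hl, rfl⟩ := hr
  unfold Wab Tab
  simp only [ENNReal.ofReal_one, ENNReal.rpow_one, one_mul, div_one]
  refine le_iInf fun μ' => le_iInf fun ν' => le_iInf fun _ => le_iInf fun _ => le_iInf fun hm => ?_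
  have h1 := int_sub_le_tv μ μ' f hf hb
  have h2 := int_sub_le_tv ν ν' f hf hb
  have h3 := int_sub_le_Wp μ' ν' hm f hl hb
  have ht : ∀ (μ ν : Measure (Rd d)) [IsFiniteMeasure μ] [IsFiniteMeasure ν], tv μ ν ≠ ⊤ := by
    intro μ ν _ _
    exact ENNReal.add_ne_top.2 ⟨measure_ne_top _ _, measure_ne_top _ _⟩
  calc ENNReal.ofReal (∫ x, f x ∂μ - ∫ x, f x ∂ν)
      ≤ ENNReal.ofReal ((tv μ μ').toReal + (tv ν ν').toReal + (∫ x, f x ∂μ' - ∫ x, f x ∂ν')) := by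
        apply ENNReal.ofReal_le_ofReal
        rw [abs_le] at h1 h2
        linarith
    _ ≤ ENNReal.ofReal ((tv μ μ').toReal + (tv ν ν').toReal)
          + ENNReal.ofReal (∫ x, f x ∂μ' - ∫ x, f x ∂ν') := ENNReal.ofReal_add_le
    _ ≤ _ := by
        rw [ENNReal.ofReal_add ENNReal.toReal_nonneg ENNReal.toReal_nonneg,
          ENNReal.ofReal_toReal (ht _ _), ENNReal.ofReal_toReal (ht _ _)]
        gcongr

theorem flatSet_bdd {d : ℕ} (μ ν : Measure (Rd d)) [IsFiniteMeasure μ] [IsFiniteMeasure ν] :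
    BddAbove (flatSet μ ν) := by
  refine ⟨(μ univ).toReal + (ν univ).toReal, ?_⟩
  rintro _ ⟨f, hf, -, hb, hl, rfl⟩
  have h1 := abs_le.1 (bl_abs_integral_le μ f hb)
  have h2 := abs_le.1 (bl_abs_integral_le ν f hb)
  linarith

theorem bl_le_sSup {d : ℕ} (μ ν : Measure (Rd d)) [IsFiniteMeasure μ] [IsFiniteMeasure ν]
    (f : Rd d → ℝ) (hl : LipschitzWith 1 f) (hb : ∀ x, |f x| ≤ 1) :
    ∫ x, f x ∂μ - ∫ x, f x ∂ν ≤ sSup (flatSet μ ν) := by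
  let k : ℕ → Rd d → ℝ := fun n x => max ((n : ℝ) - ‖x‖) 0
  let F : ℕ → Rd d → ℝ := fun n x => max (min (f x) (k n x)) (-(k n x))
  have hk : ∀ n, LipschitzWith 1 (k n) := by
    intro n
    have h1 : LipschitzWith 1 (fun x : Rd d => (n : ℝ) - ‖x‖) := by
      have := (LipschitzWith.const (n : ℝ)).sub (lipschitzWith_one_norm (E := Rd d))
      simpa using this
    exact h1.max_const 0
  have hF : ∀ n, LipschitzWith 1 (F n) := by
    intro n
    have := (hl.min (hk n)).max ((hk n).neg)
    simpa using this
  have hFb : ∀ n x, |F n x| ≤ 1 := by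
    intro n x
    have h0 : 0 ≤ k n x := le_max_right _ _
    have := abs_le.1 (hb x)
    rw [abs_le]
    simp only [F]
    refine ⟨?_, max_le ((min_le_left _ _).trans this.2) (by linarith)⟩
    by_cases h : f x ≤ k n x
    · rw [min_eq_left h]; exact this.1.trans (le_max_left _ _)
    · rw [min_eq_right (not_le.1 h).le]; exact le_trans (by linarith) (le_max_left _ _)
  have hFc : ∀ n, HasCompactSupport (F n) := by
    intro n
    refine HasCompactSupport.intro (isCompact_closedBall (0 : Rd d) n) ?_
    intro x hx
    have : (n : ℝ) < ‖x‖ := by simpa using hx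
    have h0 : k n x = 0 := max_eq_right (by linarith)
    simp only [F, h0]
    simp
  have hlim : ∀ x, Filter.Tendsto (fun n => F n x) Filter.atTop (nhds (f x)) := by
    intro x
    apply tendsto_const_nhds.congr'
    obtain ⟨N, hN⟩ := exists_nat_ge (‖x‖ + 1)
    filter_upwards [Filter.eventually_ge_atTop N] with n hn
    have hn' : (N : ℝ) ≤ n := by exact_mod_cast hn
    have h1 : 1 ≤ k n x := le_trans (by linarith) (le_max_left _ _)
    have := abs_le.1 (hb x)
    simp only [F]
    rw [min_eq_left (by linarith), max_eq_left (by linarith)]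
  have hI : ∀ (ρ : Measure (Rd d)) [IsFiniteMeasure ρ],
      Filter.Tendsto (fun n => ∫ x, F n x ∂ρ) Filter.atTop (nhds (∫ x, f x ∂ρ)) := by
    intro ρ _
    refine tendsto_integral_of_dominated_convergence (fun _ => 1)
      (fun n => (hF n).continuous.aestronglyMeasurable) (integrable_const _)
      (fun n => Filter.Eventually.of_forall (hFb n)) (Filter.Eventually.of_forall hlim)
  refine le_of_tendsto ((hI μ).sub (hI ν)) (Filter.Eventually.of_forall fun n => ?_)
  exact le_csSup (flatSet_bdd μ ν) ⟨F n, (hF n).continuous, hFc n, hFb n, hF n, rfl⟩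

theorem exists_partition {d : ℕ} (μ : Measure (Rd d)) [IsFiniteMeasure μ] (ε : ℝ) (hε : 0 < ε) :
    ∃ (N : ℕ) (x : Fin N → Rd d) (A : Fin N → Set (Rd d)), (∀ i, MeasurableSet (A i)) ∧
      Pairwise (Function.onFun Disjoint A) ∧ (∀ i, ∀ y ∈ A i, dist y (x i) ≤ ε) ∧
      μ (⋃ i, A i)ᶜ ≤ ENNReal.ofReal ε := by
  let x := TopologicalSpace.denseSeq (Rd d)
  let B : ℕ → Set (Rd d) := fun n => Metric.ball (x n) ε
  have hB : ⋃ n, B n = univ := by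
    rw [eq_univ_iff_forall]
    intro y
    obtain ⟨n, hn⟩ := (TopologicalSpace.denseRange_denseSeq (Rd d)).exists_dist_lt y hε
    exact mem_iUnion.2 ⟨n, hn⟩
  let A := disjointed B
  have hA : ∀ n, MeasurableSet (A n) :=
    fun n => MeasurableSet.disjointed (fun i => measurableSet_ball) n
  have hs : ∑' n, μ (A n) ≠ ⊤ := by
    rw [← measure_iUnion (disjoint_disjointed B) hA]
    exact measure_ne_top _ _
  have ht := ENNReal.tendsto_sum_nat_add (fun n => μ (A n)) hs
  have hpos : (0 : ℝ≥0∞) < ENNReal.ofReal ε := ENNReal.ofReal_pos.2 hε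
  obtain ⟨N, hN⟩ := (ht.eventually_lt_const hpos).exists
  refine ⟨N, fun i => x i, fun i => A i, fun i => hA i, ?_, ?_, ?_⟩
  · intro i j hij
    exact disjoint_disjointed B (fun h => hij (Fin.ext h))
  · intro i y hy
    exact (Metric.mem_ball.1 (disjointed_subset B i hy)).le
  · refine le_trans ((measure_mono ?_).trans (measure_iUnion_le (μ := μ) (fun k => A (k + N)))) hN.le
    intro y hy
    have hy' : y ∈ ⋃ n, A n := by
      rw [iUnion_disjointed, hB]; trivial
    obtain ⟨n, hn⟩ := mem_iUnion.1 hy'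
    have hnN : N ≤ n := by
      by_contra hlt
      exact hy (mem_iUnion.2 ⟨⟨n, not_le.1 hlt⟩, hn⟩)
    refine mem_iUnion.2 ⟨n - N, ?_⟩
    simpa [Nat.sub_add_cancel hnN] using hn

theorem exists_cond {d : ℕ} (μ : Measure (Rd d)) [IsFiniteMeasure μ] (ε : ℝ) (hε : 0 < ε)
    (x : Rd d) (A : Set (Rd d)) (hA : MeasurableSet A) (hx : ∀ y ∈ A, dist y x ≤ ε) :
    ∃ ρ : Measure (Rd d), IsProbabilityMeasure ρ ∧ μ.restrict A = μ A • ρ ∧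
      ∀ᵐ y ∂ρ, dist y x ≤ ε := by
  by_cases h : μ A = 0
  · refine ⟨Measure.dirac x, inferInstance, ?_, ?_⟩
    · rw [h, zero_smul, Measure.restrict_eq_zero.2 h]
    · rw [ae_dirac_iff]
      · simpa using hε.le
      · exact measurableSet_le (by fun_prop) measurable_const
  · refine ⟨(μ A)⁻¹ • μ.restrict A, ⟨?_⟩, ?_, ?_⟩
    · simp [ENNReal.inv_mul_cancel h (measure_ne_top _ _)]
    · rw [smul_smul, ENNReal.mul_inv_cancel h (measure_ne_top _ _), one_smul]
    · apply Measure.ae_smul_measure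
      exact ae_restrict_of_forall_mem hA hx

theorem tv_le {d N : ℕ} (μ : Measure (Rd d)) [IsFiniteMeasure μ] (A : Fin N → Set (Rd d))
    (hA : ∀ i, MeasurableSet (A i)) (hd : Pairwise (Function.onFun Disjoint A))
    (ρ : Fin N → Measure (Rd d)) (hρ : ∀ i, IsProbabilityMeasure (ρ i))
    (hr : ∀ i, μ.restrict (A i) = μ (A i) • ρ i) (r : Fin N → ℝ) (hr0 : ∀ i, 0 ≤ r i) :
    tv μ (∑ i, ENNReal.ofReal (r i) • ρ i) ≤
      ENNReal.ofReal (∑ i, |(μ (A i)).toReal - r i|) + μ (⋃ i, A i)ᶜ := by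
  have hμ : μ = ∑ i, ENNReal.ofReal (μ (A i)).toReal • ρ i + μ.restrict (⋃ i, A i)ᶜ := by
    conv_lhs => rw [← Measure.restrict_add_restrict_compl (μ := μ) (MeasurableSet.iUnion hA)]
    rw [Measure.restrict_iUnion hd hA, Measure.sum_fintype]
    simp only [hr, ENNReal.ofReal_toReal (measure_ne_top μ _)]
  have hle : ∀ p q : Fin N → ℝ, (∀ i, 0 ≤ q i) → ∑ i, ENNReal.ofReal (p i) • ρ i ≤
      ∑ i, ENNReal.ofReal (p i - q i) • ρ i + ∑ i, ENNReal.ofReal (q i) • ρ i := by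
    intro p q hq
    rw [← Finset.sum_add_distrib]
    refine Finset.sum_le_sum fun i _ => ?_
    rw [← add_smul]
    refine Measure.le_iff'.2 fun s => ?_
    simp only [Measure.smul_apply, smul_eq_mul]
    gcongr
    refine le_trans ?_ ENNReal.ofReal_add_le
    simp
  set a : Fin N → ℝ := fun i => (μ (A i)).toReal with ha
  have h1 : μ - ∑ i, ENNReal.ofReal (r i) • ρ i ≤
      ∑ i, ENNReal.ofReal (a i - r i) • ρ i + μ.restrict (⋃ i, A i)ᶜ := by
    apply Measure.sub_le_of_le_add
    conv_lhs => rw [hμ]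
    rw [add_right_comm]
    exact add_le_add_left (hle a r hr0) _
  have h2 : (∑ i, ENNReal.ofReal (r i) • ρ i) - μ ≤ ∑ i, ENNReal.ofReal (r i - a i) • ρ i := by
    apply Measure.sub_le_of_le_add
    refine (hle r a fun i => ENNReal.toReal_nonneg).trans ?_
    conv_rhs => rw [hμ]
    rw [← add_assoc]
    exact Measure.le_add_right le_rfl
  unfold tv
  refine (add_le_add (h1 univ) (h2 univ)).trans (le_of_eq ?_)
  rw [ENNReal.ofReal_sum_of_nonneg (fun i _ => abs_nonneg _)]
  simp only [Measure.add_apply, Measure.finsetSum_apply, Measure.smul_apply, measure_univ,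
    smul_eq_mul, mul_one, Measure.restrict_apply_univ]
  rw [add_right_comm, ← Finset.sum_add_distrib]
  congr 1
  refine Finset.sum_congr rfl fun i _ => ?_
  rcases le_total (a i) (r i) with h | h
  · rw [ENNReal.ofReal_of_nonpos (by linarith : a i - r i ≤ 0), zero_add, abs_sub_comm,
      abs_of_nonneg (by linarith)]
  · rw [ENNReal.ofReal_of_nonpos (by linarith : r i - a i ≤ 0), add_zero,
      abs_of_nonneg (by linarith)]

theorem Wp_le {d : ℕ} (γ : Measure (Rd d × Rd d)) [IsFiniteMeasure γ] :
    Wp 1 (γ.map Prod.fst) (γ.map Prod.snd) ≤ ∫⁻ q, edist q.1 q.2 ∂γ := by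
  have e1 : γ.map Prod.fst univ = γ univ := by
    rw [Measure.map_apply measurable_fst MeasurableSet.univ, preimage_univ]
  have e2 : γ.map Prod.snd univ = γ univ := by
    rw [Measure.map_apply measurable_snd MeasurableSet.univ, preimage_univ]
  unfold Wp
  rw [e1, div_one, ENNReal.rpow_one]
  by_cases h0 : γ univ = 0
  · simp [h0]
  have hT : γ univ ≠ ⊤ := measure_ne_top _ _
  have hp : IsPlan (γ.map Prod.fst) (γ.map Prod.snd) ((γ univ)⁻¹ • γ) := by
    refine ⟨⟨?_⟩, ?_, ?_⟩
    · simp [ENNReal.inv_mul_cancel h0 hT]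
    · rw [e1, Measure.map_smul]
    · rw [e2, Measure.map_smul]
  refine (mul_le_mul_right (iInf_le _ ⟨_, hp⟩) _).trans ?_
  simp only [planCost, ENNReal.rpow_one]
  rw [lintegral_smul_measure, smul_eq_mul, ← mul_assoc, ENNReal.mul_inv_cancel h0 hT, one_mul]

theorem exists_inf {d : ℕ} {ι : Type} (s : Finset ι) (g : ι → Rd d → ℝ)
    (hg : ∀ i, LipschitzWith 1 (g i)) (hg1 : ∀ i x, -1 ≤ g i x) :
    ∃ f : Rd d → ℝ, LipschitzWith 1 f ∧ (∀ x, |f x| ≤ 1) ∧ (∀ i ∈ s, ∀ x, f x ≤ g i x) ∧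
      ∀ x t, t ≤ 1 → (∀ i ∈ s, t ≤ g i x) → t ≤ f x := by
  classical
  induction s using Finset.induction_on with
  | empty =>
    exact ⟨fun _ => 1, (LipschitzWith.const 1).weaken zero_le_one, by simp, by simp,
      fun x t ht _ => ht⟩
  | insert a s ha ih =>
    obtain ⟨f, h1, h2, h3, h4⟩ := ih
    refine ⟨fun x => min (g a x) (f x), by simpa using (hg a).min h1, ?_, ?_, ?_⟩
    · intro x
      have := abs_le.1 (h2 x)
      exact abs_le.2 ⟨le_min (hg1 a x) this.1, (min_le_right _ _).trans this.2⟩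
    · intro i hi x
      rcases Finset.mem_insert.1 hi with rfl | hi
      · exact min_le_left _ _
      · exact (min_le_right _ _).trans (h3 i hi x)
    · intro x t ht h
      exact le_min (h a (Finset.mem_insert_self _ _))
        (h4 x t ht fun i hi => h i (Finset.mem_insert_of_mem hi))

theorem int_approx {d N : ℕ} (μ : Measure (Rd d)) [IsFiniteMeasure μ] (ε : ℝ) (hε : 0 < ε)
    (x : Fin N → Rd d) (A : Fin N → Set (Rd d))
    (hA : ∀ i, MeasurableSet (A i)) (hd : Pairwise (Function.onFun Disjoint A))
    (hx : ∀ i, ∀ y ∈ A i, dist y (x i) ≤ ε) (hc : μ (⋃ i, A i)ᶜ ≤ ENNReal.ofReal ε)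
    (f : Rd d → ℝ) (hl : LipschitzWith 1 f) (hb : ∀ x, |f x| ≤ 1) :
    |∫ y, f y ∂μ - ∑ i, f (x i) * (μ (A i)).toReal| ≤ ε * ((μ univ).toReal + 1) := by
  have hi : Integrable f μ := bl_integrable μ f hl.continuous hb
  have h1 : ∫ y, f y ∂μ = ∑ i, ∫ y in A i, f y ∂μ + ∫ y in (⋃ i, A i)ᶜ, f y ∂μ := by
    rw [← integral_add_compl (MeasurableSet.iUnion hA) hi,
      integral_iUnion_fintype hA hd (fun i => hi.integrableOn)]
  have h2 : ∀ i, |∫ y in A i, f y ∂μ - f (x i) * (μ (A i)).toReal| ≤ ε * (μ (A i)).toReal := by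
    intro i
    have e : ∫ y in A i, f y ∂μ - f (x i) * (μ (A i)).toReal = ∫ y in A i, (f y - f (x i)) ∂μ := by
      rw [integral_sub hi.integrableOn (integrable_const _)]
      simp [Measure.real, mul_comm]
    rw [e, ← Real.norm_eq_abs]
    refine norm_setIntegral_le_of_norm_le_const (measure_lt_top μ _) ?_
    intro y hy
    rw [← dist_eq_norm]
    have := hl.dist_le_mul y (x i)
    simp only [NNReal.coe_one, one_mul] at this
    exact this.trans (hx i y hy)
  have h3 : |∫ y in (⋃ i, A i)ᶜ, f y ∂μ| ≤ ε := by
    have := bl_abs_integral_le (μ.restrict (⋃ i, A i)ᶜ) f hb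
    refine this.trans ?_
    rw [Measure.restrict_apply_univ]
    exact ENNReal.toReal_le_of_le_ofReal hε.le hc
  have h4 : ∑ i, (μ (A i)).toReal ≤ (μ univ).toReal := by
    rw [← ENNReal.toReal_sum (fun i _ => measure_ne_top μ _)]
    apply ENNReal.toReal_mono (measure_ne_top _ _)
    rw [← tsum_fintype (L := .unconditional _), ← measure_iUnion hd hA]
    exact measure_mono (subset_univ _)
  rw [h1, add_sub_right_comm, ← Finset.sum_sub_distrib]
  refine (abs_add_le _ _).trans ?_
  have h5 := (Finset.abs_sum_le_sum_abs (fun i => ∫ y in A i, f y ∂μ - f (x i) * (μ (A i)).toReal)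
    Finset.univ).trans (Finset.sum_le_sum fun i _ => h2 i)
  rw [← Finset.mul_sum] at h5
  have h6 := mul_le_mul_of_nonneg_left h4 hε.le
  linarith

theorem Wab_le {d : ℕ} (μ ν : Measure (Rd d)) [IsFiniteMeasure μ] [IsFiniteMeasure ν]
    (ε : ℝ) (hε : 0 < ε) :
    Wab 1 1 1 μ ν ≤ ENNReal.ofReal (sSup (flatSet μ ν)
      + ε * ((μ univ).toReal + 3 * (ν univ).toReal + 4)) := by
  obtain ⟨N, x, A, hA, hd, hx, hc⟩ := exists_partition (μ + ν) ε hε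
  have hcμ : μ (⋃ i, A i)ᶜ ≤ ENNReal.ofReal ε :=
    le_trans (by rw [Measure.add_apply]; exact le_self_add) hc
  have hcν : ν (⋃ i, A i)ᶜ ≤ ENNReal.ofReal ε :=
    le_trans (by rw [Measure.add_apply]; exact le_add_self) hc
  choose ρ hρ hρr hρx using fun i => exists_cond μ ε hε (x i) (A i) (hA i) (hx i)
  choose σ hσ hσr hσx using fun i => exists_cond ν ε hε (x i) (A i) (hA i) (hx i)
  obtain ⟨γ, u, v, hγ, hu, hv, huv, hF⟩ := finite_duality
    (fun i j => dist (x i) (x j) + 2 * ε) (fun i j => by positivity)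
    (fun i => (μ (A i)).toReal) (fun i => (ν (A i)).toReal)
  -- the dual side
  obtain ⟨f, hfl, hfb, hfg, hfu⟩ := exists_inf (Finset.univ : Finset (Fin N))
    (fun j y => dist y (x j) + 2 * ε - v j)
    (by
      intro j
      have h := (LipschitzWith.dist_left (x j)).add (LipschitzWith.const (2 * ε - v j))
      simpa [add_sub_assoc] using h)
    (by
      intro j y
      have := (abs_le.1 (hv j)).2
      have := dist_nonneg (x := y) (y := x j)
      linarith)
  have hdual : ∑ i, u i * (μ (A i)).toReal + ∑ j, v j * (ν (A j)).toReal ≤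
      sSup (flatSet μ ν) + ε * ((μ univ).toReal + 3 * (ν univ).toReal + 2) := by
    have h1 := abs_le.1 (int_approx μ ε hε x A hA hd hx hcμ f hfl hfb)
    have h2 := abs_le.1 (int_approx ν ε hε x A hA hd hx hcν f hfl hfb)
    have h3 := bl_le_sSup μ ν f hfl hfb
    have h4 : ∑ i, u i * (μ (A i)).toReal ≤ ∑ i, f (x i) * (μ (A i)).toReal := by
      refine Finset.sum_le_sum fun i _ => mul_le_mul_of_nonneg_right ?_ ENNReal.toReal_nonneg
      refine hfu _ _ (abs_le.1 (hu i)).2 fun j _ => ?_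
      have := huv i j
      linarith
    have h5 : ∑ j, v j * (ν (A j)).toReal ≤ 2 * ε * ∑ j, (ν (A j)).toReal
        - ∑ j, f (x j) * (ν (A j)).toReal := by
      rw [Finset.mul_sum, ← Finset.sum_sub_distrib]
      refine Finset.sum_le_sum fun j _ => ?_
      rw [← sub_mul]
      refine mul_le_mul_of_nonneg_right ?_ ENNReal.toReal_nonneg
      have := hfg j (Finset.mem_univ j) (x j)
      simp only [dist_self] at this
      linarith
    have h6 : ∑ i, (ν (A i)).toReal ≤ (ν univ).toReal := by
      rw [← ENNReal.toReal_sum (fun i _ => measure_ne_top ν _)]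
      apply ENNReal.toReal_mono (measure_ne_top _ _)
      rw [← tsum_fintype (L := .unconditional _), ← measure_iUnion hd hA]
      exact measure_mono (subset_univ _)
    have h7 := mul_le_mul_of_nonneg_left h6 (by positivity : 0 ≤ 2 * ε)
    linarith
  -- the primal side
  let Γ : Measure (Rd d × Rd d) := ∑ i, ∑ j, ENNReal.ofReal (γ i j) • (ρ i).prod (σ j)
  have hmeas1 : AEMeasurable (Prod.fst : Rd d × Rd d → Rd d) Γ := measurable_fst.aemeasurable
  have hΓfin : IsFiniteMeasure Γ := by
    refine ⟨?_⟩
    simp only [Γ, Measure.finsetSum_apply, Measure.smul_apply, measure_univ, smul_eq_mul, mul_one]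
    exact ENNReal.sum_lt_top.2 fun i _ => ENNReal.sum_lt_top.2 fun j _ => ENNReal.ofReal_lt_top
  have hfst : Γ.map Prod.fst = ∑ i, ENNReal.ofReal (∑ j, γ i j) • ρ i := by
    ext s hs
    rw [Measure.map_apply measurable_fst hs]
    simp only [Γ, Measure.finsetSum_apply, Measure.smul_apply, smul_eq_mul]
    refine Finset.sum_congr rfl fun i _ => ?_
    rw [ENNReal.ofReal_sum_of_nonneg (fun j _ => hγ i j), Finset.sum_mul]
    refine Finset.sum_congr rfl fun j _ => ?_
    rw [← prod_univ, Measure.prod_prod, measure_univ, mul_one]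
  have hsnd : Γ.map Prod.snd = ∑ j, ENNReal.ofReal (∑ i, γ i j) • σ j := by
    ext s hs
    rw [Measure.map_apply measurable_snd hs]
    simp only [Γ, Measure.finsetSum_apply, Measure.smul_apply, smul_eq_mul]
    rw [Finset.sum_comm]
    refine Finset.sum_congr rfl fun j _ => ?_
    rw [ENNReal.ofReal_sum_of_nonneg (fun i _ => hγ i j), Finset.sum_mul]
    refine Finset.sum_congr rfl fun i _ => ?_
    rw [← univ_prod, Measure.prod_prod, measure_univ, one_mul]
  have hcost : ∫⁻ q, edist q.1 q.2 ∂Γ ≤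
      ENNReal.ofReal (∑ i, ∑ j, (dist (x i) (x j) + 2 * ε) * γ i j) := by
    have hnn : ∀ i j, 0 ≤ (dist (x i) (x j) + 2 * ε) * γ i j :=
      fun i j => mul_nonneg (by positivity) (hγ i j)
    rw [ENNReal.ofReal_sum_of_nonneg (fun i _ => Finset.sum_nonneg fun j _ => hnn i j)]
    simp only [Γ, lintegral_finsetSum_measure, lintegral_smul_measure]
    refine Finset.sum_le_sum fun i _ => ?_
    rw [ENNReal.ofReal_sum_of_nonneg (fun j _ => hnn i j)]
    refine Finset.sum_le_sum fun j _ => ?_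
    rw [smul_eq_mul, mul_comm, ENNReal.ofReal_mul (by positivity)]
    gcongr
    have hae1 : ∀ᵐ q ∂((ρ i).prod (σ j)), dist q.1 (x i) ≤ ε :=
      Measure.quasiMeasurePreserving_fst.ae (hρx i)
    have hae2 : ∀ᵐ q ∂((ρ i).prod (σ j)), dist q.2 (x j) ≤ ε :=
      Measure.quasiMeasurePreserving_snd.ae (hσx j)
    calc ∫⁻ q, edist q.1 q.2 ∂((ρ i).prod (σ j))
        ≤ ∫⁻ q, ENNReal.ofReal (dist (x i) (x j) + 2 * ε) ∂((ρ i).prod (σ j)) := by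
          apply lintegral_mono_ae
          filter_upwards [hae1, hae2] with q h1 h2
          rw [edist_dist]
          apply ENNReal.ofReal_le_ofReal
          have := dist_triangle4 q.1 (x i) (x j) q.2
          rw [dist_comm (x j) q.2] at this
          linarith
      _ = _ := by simp
  have ht1 := tv_le μ A hA hd ρ hρ hρr (fun i => ∑ j, γ i j)
    (fun i => Finset.sum_nonneg fun j _ => hγ i j)
  have ht2 := tv_le ν A hA hd σ hσ hσr (fun j => ∑ i, γ i j)
    (fun j => Finset.sum_nonneg fun i _ => hγ i j)
  rw [← hfst] at ht1
  rw [← hsnd] at ht2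
  have hW := (Wp_le Γ).trans hcost
  have hf1 : IsFiniteMeasure (Γ.map Prod.fst) := inferInstance
  have hf2 : IsFiniteMeasure (Γ.map Prod.snd) := inferInstance
  unfold Wab Tab
  simp only [ENNReal.ofReal_one, ENNReal.rpow_one, one_mul, div_one]
  refine (iInf_le_of_le (Γ.map Prod.fst) <| iInf_le_of_le (Γ.map Prod.snd) <|
    iInf_le_of_le hf1 <| iInf_le_of_le hf2 <| iInf_le_of_le ?_ le_rfl).trans ?_
  · rw [Measure.map_apply measurable_fst MeasurableSet.univ,
      Measure.map_apply measurable_snd MeasurableSet.univ, preimage_univ, preimage_univ]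
  refine (add_le_add (add_le_add (ht1.trans (add_le_add_right hcμ _))
    (ht2.trans (add_le_add_right hcν _))) hW).trans ?_
  have p1 : 0 ≤ ∑ i, |(μ (A i)).toReal - ∑ j, γ i j| := by positivity
  have p2 : 0 ≤ ∑ j, |(ν (A j)).toReal - ∑ i, γ i j| := by positivity
  have p3 : 0 ≤ ∑ i, ∑ j, (dist (x i) (x j) + 2 * ε) * γ i j :=
    Finset.sum_nonneg fun i _ => Finset.sum_nonneg fun j _ => mul_nonneg (by positivity) (hγ i j)
  rw [← ENNReal.ofReal_add p1 hε.le, ← ENNReal.ofReal_add p2 hε.le,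
    ← ENNReal.ofReal_add (by linarith) (by linarith), ← ENNReal.ofReal_add (by linarith) p3]
  apply ENNReal.ofReal_le_ofReal
  linarith

/-- the generalized Wasserstein distance `W_1^{1,1}` coincides with the
flat metric (bounded Lipschitz distance). -/
theorem W11_eq_flat {d : ℕ} (μ ν : Measure (Rd d)) (hμ : finMom 1 μ) (hν : finMom 1 ν) :
    (Wab 1 1 1 μ ν).toReal =
      sSup {r : ℝ | ∃ f : Rd d → ℝ, Continuous f ∧ HasCompactSupport f ∧
        (∀ x, |f x| ≤ 1) ∧ LipschitzWith 1 f ∧ r = ∫ x, f x ∂μ - ∫ x, f x ∂ν} := by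
  have := hμ.1
  have := hν.1
  change (Wab 1 1 1 μ ν).toReal = sSup (flatSet μ ν)
  have h0 : (0 : ℝ) ∈ flatSet μ ν :=
    ⟨fun _ => 0, continuous_const, HasCompactSupport.zero, by simp,
      (LipschitzWith.const 0).weaken zero_le_one, by simp⟩
  have hS : 0 ≤ sSup (flatSet μ ν) := le_csSup (flatSet_bdd μ ν) h0
  have hfin : Wab 1 1 1 μ ν ≠ ⊤ :=
    ((Wab_le μ ν 1 one_pos).trans_lt ENNReal.ofReal_lt_top).ne
  apply le_antisymm
  · set K : ℝ := (μ univ).toReal + 3 * (ν univ).toReal + 4 with hK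
    have hK0 : 0 < K := by positivity
    refine le_of_forall_pos_le_add fun δ hδ => ?_
    have h := Wab_le μ ν (δ / K) (div_pos hδ hK0)
    rw [← hK, div_mul_cancel₀ _ hK0.ne'] at h
    exact ENNReal.toReal_le_of_le_ofReal (by positivity) h
  · refine csSup_le ⟨0, h0⟩ fun r hr => ?_
    exact (ENNReal.ofReal_le_iff_le_toReal hfin).1 (flatSet_le μ ν hr)
end
end
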